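/- Let K₁ and K₂ be geometric simplicial triangulations of the round sphere S^n (triangulations by spherical geodesic simplices) such that in each K_i the star of every simplex has diameter less than π (in the intrinsic metric of S^n). Then there exists s ∈ ℕ and s-fold derived subdivisions β^s K₁ and β^s K₂ such that β^s K₁ and β^s K₂ are related by a finite sequence of geometric bistellar moves. -/

import Mathlib

open Set
open scoped Classical RealInnerProductSpace

/-- The spherical geodesic simplex spanned by a finite set `s` of unit vectors: the radial
projection to the unit sphere of the convex hull of `s`. -/
noncomputable def sphSimplex {m : ℕ} (s : Finset (EuclideanSpace ℝ (Fin m))) :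
    Set (EuclideanSpace ℝ (Fin m)) :=
  (fun y => ‖y‖⁻¹ • y) '' (convexHull ℝ (s : Set (EuclideanSpace ℝ (Fin m))) \ {0})

/-- A geometric (spherical) simplicial complex in the unit sphere `Sⁿ ⊂ ℝ^{n+1}`: a finite
collection of spherical geodesic simplices, recorded by their (linearly independent) vertex
sets of unit vectors, closed under passing to faces, and such that any two simplices intersect
in the (possibly empty) common face spanned by their common vertices. -/
structure SphericalComplex (n : ℕ) where
  faces : Set (Finset (EuclideanSpace ℝ (Fin (n + 1))))
  finite' : faces.Finite
  nonempty_mem : ∀ s ∈ faces, s.Nonempty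
  unit : ∀ s ∈ faces, ∀ v ∈ s, ‖v‖ = 1
  indep : ∀ s ∈ faces, LinearIndependent ℝ
    (fun v : {x // x ∈ s} => (v : EuclideanSpace ℝ (Fin (n + 1))))
  down_closed : ∀ s ∈ faces, ∀ t, t ⊆ s → t.Nonempty → t ∈ faces
  inter : ∀ s ∈ faces, ∀ t ∈ faces, sphSimplex s ∩ sphSimplex t = sphSimplex (s ∩ t)

/-- The support of a spherical complex. -/
def SphericalComplex.space {n : ℕ} (K : SphericalComplex n) :
    Set (EuclideanSpace ℝ (Fin (n + 1))) :=
  ⋃ s ∈ K.faces, sphSimplex s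

/-- The (relative) interior of a spherical simplex: the simplex minus its proper faces. -/
noncomputable def sphInterior {m : ℕ} (s : Finset (EuclideanSpace ℝ (Fin m))) :
    Set (EuclideanSpace ℝ (Fin m)) :=
  sphSimplex s \ ⋃ t ∈ {t : Finset (EuclideanSpace ℝ (Fin m)) | t ⊂ s}, sphSimplex t

/-- The star of a simplex `A` in a spherical complex `K`, as a subset of the sphere: the union
of the (closed) simplices of `K` containing `A`. -/
def sphStar {n : ℕ} (K : SphericalComplex n) (A : Finset (EuclideanSpace ℝ (Fin (n + 1)))) :
    Set (EuclideanSpace ℝ (Fin (n + 1))) :=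
  ⋃ t ∈ {t | t ∈ K.faces ∧ A ⊆ t}, sphSimplex t

/-- `K'` is a derived subdivision of the spherical complex `K`: an interior point `b A` of each
simplex `A` of `K` is chosen, and the simplices of `K'` are the geodesic joins of
`{b A₀, …, b Aₖ}` over chains `A₀ ⊊ ⋯ ⊊ Aₖ` of simplices of `K`. -/
def SphIsDerived {n : ℕ} (K' K : SphericalComplex n) : Prop :=
  ∃ b : Finset (EuclideanSpace ℝ (Fin (n + 1))) → EuclideanSpace ℝ (Fin (n + 1)),
    (∀ s ∈ K.faces, b s ∈ sphInterior s) ∧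
    K'.faces = {S | ∃ T : Finset (Finset (EuclideanSpace ℝ (Fin (n + 1)))),
      ↑T ⊆ K.faces ∧ T.Nonempty ∧ (∀ A ∈ T, ∀ B ∈ T, A ⊆ B ∨ B ⊆ A) ∧ S = T.image b}

/-- `K'` is an `s`-fold iterated derived subdivision of the spherical complex `K`. -/
def SphIterDerived {n : ℕ} : ℕ → SphericalComplex n → SphericalComplex n → Prop
  | 0, K', K => K' = K
  | (s + 1), K', K => ∃ K'', SphIterDerived s K'' K ∧ SphIsDerived K' K''

/-- The geometric bistellar move `κ(A,B)` on a spherical complex triangulating `Sⁿ`: `A` is a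
simplex of `K`, `B` a spherical simplex not in `K` with `dim A + dim B = n`, the link of `A`
in `K` is the boundary complex of `B`, and `K'` is obtained by replacing `A ⋆ ∂B` with
`∂A ⋆ B` (joins being geodesic). -/
def SphBistellarMove {n : ℕ} (K K' : SphericalComplex n) : Prop :=
  ∃ A B : Finset (EuclideanSpace ℝ (Fin (n + 1))), A ∈ K.faces ∧ B ∉ K.faces ∧ B.Nonempty ∧
    A.card + B.card = n + 2 ∧
    {C : Finset (EuclideanSpace ℝ (Fin (n + 1))) |
        C.Nonempty ∧ Disjoint A C ∧ A ∪ C ∈ K.faces} =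
      {C : Finset (EuclideanSpace ℝ (Fin (n + 1))) | C.Nonempty ∧ C ⊂ B} ∧
    K'.faces = (K.faces \ {s | A ⊆ s}) ∪
      {s | ∃ A' : Finset (EuclideanSpace ℝ (Fin (n + 1))), A' ⊂ A ∧ s = A' ∪ B}

namespace SphFan

set_option linter.unusedSectionVars false

/-! ### Positive combinations and independent sets -/

section Basic

variable {E : Type*} [NormedAddCommGroup E] [InnerProductSpace ℝ E]

/-- `x` lies in the relative interior of the cone over `s`. -/
def PosComb (s : Finset E) (x : E) : Prop :=
  ∃ a : E → ℝ, (∀ v ∈ s, 0 < a v) ∧ ∑ v ∈ s, a v • v = x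

/-- `x` lies in the closed cone over `s`. -/
def InCone (s : Finset E) (x : E) : Prop :=
  ∃ a : E → ℝ, (∀ v ∈ s, 0 ≤ a v) ∧ ∑ v ∈ s, a v • v = x

/-- Linear independence of a finite set of vectors. -/
def Indep (s : Finset E) : Prop :=
  ∀ a : E → ℝ, ∑ v ∈ s, a v • v = 0 → ∀ v ∈ s, a v = 0

lemma indep_iff {s : Finset E} : Indep s ↔ LinearIndepOn ℝ id (s : Set E) := by
  rw [linearIndepOn_finset_iff]; rfl

lemma PosComb.inCone {s : Finset E} {x : E} (h : PosComb s x) : InCone s x := by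
  obtain ⟨a, ha, hx⟩ := h
  exact ⟨a, fun v hv => (ha v hv).le, hx⟩

lemma sum_smul_subset [DecidableEq E] {s t : Finset E} (h : s ⊆ t) (a : E → ℝ) :
    ∑ v ∈ t, (if v ∈ s then a v else 0) • v = ∑ v ∈ s, a v • v := by
  rw [← Finset.sum_subset h (f := fun v => (if v ∈ s then a v else 0) • v)]
  · exact Finset.sum_congr rfl fun v hv => by simp [hv]
  · intro v _ hv; simp [hv]

lemma InCone.mono {s t : Finset E} {x : E} (h : InCone s x) (hst : s ⊆ t) : InCone t x := by
  obtain ⟨a, ha, hx⟩ := h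
  refine ⟨fun v => if v ∈ s then a v else 0, fun v _ => ?_, by rw [sum_smul_subset hst, hx]⟩
  dsimp only; split_ifs with h
  · exact ha v h
  · exact le_rfl

lemma sum_smul_filter_ne_zero (s : Finset E) (a : E → ℝ) :
    ∑ v ∈ s with a v ≠ 0, a v • v = ∑ v ∈ s, a v • v := by
  rw [Finset.sum_filter]
  refine Finset.sum_congr rfl fun v _ => ?_
  by_cases h : a v = 0 <;> simp [h]

lemma InCone.exists_posComb {t : Finset E} {x : E} (h : InCone t x) :
    ∃ s ⊆ t, PosComb s x := by
  obtain ⟨a, ha, hx⟩ := h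
  refine ⟨t.filter fun v => a v ≠ 0, Finset.filter_subset _ _, a, fun v hv => ?_, ?_⟩
  · rw [Finset.mem_filter] at hv
    exact lt_of_le_of_ne (ha v hv.1) (Ne.symm hv.2)
  · rw [sum_smul_filter_ne_zero, hx]

lemma inCone_self {s : Finset E} {v : E} (hv : v ∈ s) : InCone s v :=
  ⟨fun w => if w = v then 1 else 0, fun w _ => by dsimp only; split_ifs <;> norm_num, by
    simp [ite_smul, Finset.sum_ite_eq', hv]⟩

lemma posComb_singleton (v : E) : PosComb {v} v := ⟨fun _ => 1, by simp, by simp⟩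

lemma posComb_empty {x : E} : PosComb ∅ x ↔ x = 0 :=
  ⟨fun ⟨_, _, h⟩ => by simpa using h.symm, fun h => ⟨fun _ => 0, by simp, by simp [h]⟩⟩

lemma PosComb.smul {s : Finset E} {x : E} (h : PosComb s x) {c : ℝ} (hc : 0 < c) :
    PosComb s (c • x) := by
  obtain ⟨a, ha, rfl⟩ := h
  exact ⟨fun v => c * a v, fun v hv => mul_pos hc (ha v hv), by simp [Finset.smul_sum, mul_smul]⟩

lemma inCone_zero (s : Finset E) : InCone s (0 : E) := ⟨fun _ => 0, by simp, by simp⟩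

lemma InCone.add {s : Finset E} {x y : E} (hx : InCone s x) (hy : InCone s y) :
    InCone s (x + y) := by
  obtain ⟨a, ha, rfl⟩ := hx
  obtain ⟨b, hb, rfl⟩ := hy
  exact ⟨fun v => a v + b v, fun v hv => add_nonneg (ha v hv) (hb v hv), by
    simp [add_smul, Finset.sum_add_distrib]⟩

lemma InCone.smul {s : Finset E} {x : E} (h : InCone s x) {c : ℝ} (hc : 0 ≤ c) :
    InCone s (c • x) := by
  obtain ⟨a, ha, rfl⟩ := h
  exact ⟨fun v => c * a v, fun v hv => mul_nonneg hc (ha v hv), by simp [Finset.smul_sum, mul_smul]⟩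

lemma inCone_sum {ι : Type*} (I : Finset ι) {s : Finset E} (y : ι → E) (a : ι → ℝ)
    (ha : ∀ i ∈ I, 0 ≤ a i) (hy : ∀ i ∈ I, InCone s (y i)) : InCone s (∑ i ∈ I, a i • y i) :=
  Finset.sum_induction _ (InCone s) (fun _ _ => InCone.add) (inCone_zero s)
    fun i hi => (hy i hi).smul (ha i hi)

lemma InCone.trans {s t : Finset E} {x : E} (h : InCone s x) (hst : ∀ v ∈ s, InCone t v) :
    InCone t x := by
  obtain ⟨a, ha, rfl⟩ := h
  exact inCone_sum s (fun v => v) a ha hst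

/-- A positive combination of relative interior points lies in the relative interior of the
cone over the union. -/
lemma posComb_biUnion [DecidableEq E] {ι : Type*} (I : Finset ι) (ρ : ι → Finset E) (y : ι → E)
    (a : ι → ℝ) (ha : ∀ i ∈ I, 0 < a i) (hy : ∀ i ∈ I, PosComb (ρ i) (y i)) :
    PosComb (I.biUnion ρ) (∑ i ∈ I, a i • y i) := by
  choose! c hc hcy using hy
  refine ⟨fun v => ∑ i ∈ I, if v ∈ ρ i then a i * c i v else 0, fun v hv => ?_, ?_⟩
  · obtain ⟨i, hi, hvi⟩ := Finset.mem_biUnion.1 hv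
    refine Finset.sum_pos' (fun j hj => ?_) ⟨i, hi, ?_⟩
    · split_ifs with h
      · exact (mul_pos (ha j hj) (hc j hj v h)).le
      · exact le_rfl
    · rw [if_pos hvi]; exact mul_pos (ha i hi) (hc i hi v hvi)
  · simp only [Finset.sum_smul]
    rw [Finset.sum_comm]
    refine Finset.sum_congr rfl fun i hi => ?_
    rw [← hcy i hi, sum_smul_subset (Finset.subset_biUnion_of_mem ρ hi) (fun v => a i * c i v),
      Finset.smul_sum]
    simp [mul_smul]

lemma Indep.subset {s t : Finset E} (h : Indep t) (hst : s ⊆ t) : Indep s := by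
  rw [indep_iff] at h ⊢
  exact h.mono (by exact_mod_cast hst)

lemma Indep.coeff_eq {s : Finset E} (h : Indep s) {a b : E → ℝ}
    (hab : ∑ v ∈ s, a v • v = ∑ v ∈ s, b v • v) : ∀ v ∈ s, a v = b v := by
  intro v hv
  have := h (fun v => a v - b v) (by simp [sub_smul, Finset.sum_sub_distrib, hab]) v hv
  exact sub_eq_zero.1 this

lemma inner_sum_smul (ℓ : E) (s : Finset E) (a : E → ℝ) :
    ⟪ℓ, ∑ v ∈ s, a v • v⟫ = ∑ v ∈ s, a v * ⟪ℓ, v⟫ := by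
  simp [inner_sum, inner_smul_right]

lemma inner_dual_sum {s : Finset E} {u : E → E}
    (hu : ∀ v ∈ s, ∀ w ∈ s, ⟪u v, w⟫ = if v = w then 1 else 0) (a : E → ℝ) {v : E} (hv : v ∈ s) :
    ⟪u v, ∑ w ∈ s, a w • w⟫ = a v := by
  rw [inner_sum_smul, Finset.sum_congr rfl fun w hw => by rw [hu v hv w hw]]
  simp [hv]

lemma inner_sum_dual {s : Finset E} {u : E → E}
    (hu : ∀ v ∈ s, ∀ w ∈ s, ⟪u v, w⟫ = if v = w then 1 else 0) (a : E → ℝ) {v : E} (hv : v ∈ s) :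
    ⟪∑ w ∈ s, a w • u w, v⟫ = a v := by
  rw [sum_inner, Finset.sum_congr rfl fun w hw => by rw [real_inner_smul_left, hu w hw v hv]]
  simp [hv]

lemma inCone_of_dual_nonneg {s : Finset E} {u : E → E}
    (hu : ∀ v ∈ s, ∀ w ∈ s, ⟪u v, w⟫ = if v = w then 1 else 0) {x : E}
    (hx : ∃ a : E → ℝ, ∑ v ∈ s, a v • v = x) (hpos : ∀ v ∈ s, 0 ≤ ⟪u v, x⟫) : InCone s x := by
  obtain ⟨a, rfl⟩ := hx
  exact ⟨a, fun v hv => by simpa [inner_dual_sum hu a hv] using hpos v hv, rfl⟩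

variable [FiniteDimensional ℝ E]

/-- Values on an independent set can be prescribed for a linear functional. -/
lemma Indep.exists_inner_eq {s : Finset E} (h : Indep s) (c : E → ℝ) :
    ∃ ℓ : E, ∀ v ∈ s, ⟪ℓ, v⟫ = c v := by
  have hli := indep_iff.1 h
  let B := Module.Basis.extend hli
  let φ : E →ₗ[ℝ] ℝ := B.constr ℝ fun i => c i
  refine ⟨(InnerProductSpace.toDual ℝ E).symm φ.toContinuousLinearMap, fun v hv => ?_⟩
  rw [InnerProductSpace.toDual_symm_apply]
  have hv' : v ∈ hli.extend (Set.subset_univ _) := hli.subset_extend _ (by exact_mod_cast hv)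
  have h1 : B ⟨v, hv'⟩ = v := Module.Basis.extend_apply_self hli ⟨v, hv'⟩
  change φ v = c v
  conv_lhs => rw [← h1]
  simp [φ]

lemma Indep.exists_dual {s : Finset E} (h : Indep s) :
    ∃ u : E → E, ∀ v ∈ s, ∀ w ∈ s, ⟪u v, w⟫ = if v = w then 1 else 0 := by
  choose u hu using fun v : E => h.exists_inner_eq fun w => if v = w then 1 else 0
  exact ⟨u, fun v _ w hw => hu v w hw⟩

lemma Indep.card_le {s : Finset E} (h : Indep s) : s.card ≤ Module.finrank ℝ E := by
  by_contra hlt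
  obtain ⟨f, hf, x, hx, hfx⟩ :=
    Module.exists_nontrivial_relation_of_finrank_lt_card (R := ℝ) (not_le.1 hlt)
  exact hfx (h f hf x hx)

lemma Indep.exists_sum_eq {s : Finset E} (h : Indep s) (hc : s.card = Module.finrank ℝ E) (x : E) :
    ∃ a : E → ℝ, ∑ v ∈ s, a v • v = x := by
  have h1 : LinearIndependent ℝ (fun v : (s : Set E) => (v : E)) := indep_iff.1 h
  have h2 := h1.span_eq_top_of_card_eq_finrank' (by simpa using hc)
  have h3 : x ∈ Submodule.span ℝ (s : Set E) := by
    have : Set.range (fun v : (s : Set E) => (v : E)) = s := Subtype.range_coe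
    rw [this] at h2; rw [h2]; trivial
  obtain ⟨f, -, hf⟩ := Submodule.mem_span_finset.1 h3
  exact ⟨f, hf⟩

end Basic

/-! ### Simplicial fans -/

section Fan

variable {E : Type*} [NormedAddCommGroup E] [InnerProductSpace ℝ E]

/-- A collection of vertex sets (including the empty one) whose open cones are disjoint. -/
structure IsFan (F : Set (Finset E)) : Prop where
  finite : F.Finite
  empty_mem : ∅ ∈ F
  unit : ∀ s ∈ F, ∀ v ∈ s, ‖v‖ = 1
  down : ∀ s ∈ F, ∀ t ⊆ s, t ∈ F
  uniq : ∀ s ∈ F, ∀ t ∈ F, ∀ x, PosComb s x → PosComb t x → s = t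

/-- The open cones of `F` cover the space. -/
def Complete (F : Set (Finset E)) : Prop := ∀ x, ∃ s ∈ F, PosComb s x

lemma IsFan.indep {F : Set (Finset E)} (hF : IsFan F) {s : Finset E} (hs : s ∈ F) : Indep s := by
  intro a ha v hv
  set P := s.filter fun v => 0 < a v
  set N := s.filter fun v => a v < 0
  have hsplit : ∑ v ∈ P, a v • v = ∑ v ∈ N, (-a v) • v := by
    simp only [neg_smul, Finset.sum_neg_distrib]
    rw [eq_neg_iff_add_eq_zero, Finset.sum_filter, Finset.sum_filter,
      ← Finset.sum_add_distrib]
    refine (Finset.sum_congr rfl fun v _ => ?_).trans ha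
    rcases lt_trichotomy (a v) 0 with h | h | h
    · simp [h, h.not_gt]
    · simp [h]
    · simp [h, h.not_gt]
  have hPN : P = N := hF.uniq P (hF.down s hs P (Finset.filter_subset _ _)) N
    (hF.down s hs N (Finset.filter_subset _ _)) _ ⟨a, fun v hv => (Finset.mem_filter.1 hv).2, rfl⟩
    ⟨fun v => -a v, fun v hv => neg_pos.2 (Finset.mem_filter.1 hv).2, hsplit.symm⟩
  rcases lt_trichotomy (a v) 0 with h | h | h
  · have : v ∈ P := hPN ▸ Finset.mem_filter.2 ⟨hv, h⟩
    exact absurd (Finset.mem_filter.1 this).2 h.not_gt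
  · exact h
  · have : v ∈ N := hPN ▸ Finset.mem_filter.2 ⟨hv, h⟩
    exact absurd (Finset.mem_filter.1 this).2 h.not_gt

lemma IsFan.subset_of_inCone {F : Set (Finset E)} (hF : IsFan F) {s t : Finset E} (hs : s ∈ F)
    (ht : t ∈ F) {x : E} (hx : PosComb s x) (hxt : InCone t x) : s ⊆ t := by
  obtain ⟨t', ht', h⟩ := hxt.exists_posComb
  rw [hF.uniq s hs t' (hF.down t ht t' ht') x hx h]; exact ht'

lemma IsFan.singleton_mem {F : Set (Finset E)} (hF : IsFan F) {s : Finset E} (hs : s ∈ F) {v : E}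
    (hv : v ∈ s) : {v} ∈ F := hF.down s hs _ (by simpa using hv)

lemma IsFan.ne_zero {F : Set (Finset E)} (hF : IsFan F) {s : Finset E} (hs : s ∈ F) {v : E}
    (hv : v ∈ s) : v ≠ 0 := by
  rintro rfl
  simpa using hF.unit s hs 0 hv

/-- If a face `A` of a refinement has a relative interior point in the cone over `σ`, then all
of `A` lies in the cone over `σ`. -/
lemma IsFan.inCone_of_posComb [DecidableEq E] {F : Set (Finset E)} (hF : IsFan F)
    {σ σ' A : Finset E} (hσ : σ ∈ F) (hσ' : σ' ∈ F) (hA : ∀ v ∈ A, InCone σ' v) {x : E}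
    (hx : PosComb A x) (hxσ : InCone σ x) : ∀ v ∈ A, InCone σ v := by
  choose! ρ hρ hρv using fun v hv => (hA v hv).exists_posComb
  obtain ⟨a, ha, rfl⟩ := hx
  have h1 := posComb_biUnion A ρ (fun v => v) a ha hρv
  have h2 : A.biUnion ρ ⊆ σ' := Finset.biUnion_subset.2 hρ
  have h3 := hF.subset_of_inCone (hF.down _ hσ' _ h2) hσ h1 hxσ
  exact fun v hv => (hρv v hv).inCone.mono ((Finset.subset_biUnion_of_mem ρ hv).trans h3)

variable [FiniteDimensional ℝ E]

/-- A complete fan is pure. -/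
lemma IsFan.exists_facet {F : Set (Finset E)} (hF : IsFan F) (hc : Complete F) {s : Finset E}
    (hs : s ∈ F) : ∃ t ∈ F, s ⊆ t ∧ t.card = Module.finrank ℝ E := by
  set x := ∑ v ∈ s, (1 : ℝ) • v with hx
  have hsx : PosComb s x := ⟨fun _ => 1, by simp, rfl⟩
  have key : ∀ y : E, ∃ t ∈ F, s ⊆ t ∧ y ∈ Submodule.span ℝ (t : Set E) := by
    intro y
    have hfr : ∃ t ∈ F, ∃ᶠ ε : ℝ in nhdsWithin 0 (Ioi 0), PosComb t (x + ε • y) := by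
      by_contra hcon
      push Not at hcon
      have := (Filter.eventually_all_finite hF.finite).2 fun t ht =>
        Filter.not_frequently.1 (Filter.not_frequently.2 (hcon t ht))
      obtain ⟨ε, hε⟩ := this.exists
      obtain ⟨t, ht, h⟩ := hc (x + ε • y)
      exact hε t ht h
    obtain ⟨t, ht, hfr⟩ := hfr
    have hmem : ∀ ε : ℝ, PosComb t (x + ε • y) → x + ε • y ∈ Submodule.span ℝ (t : Set E) := by
      rintro ε ⟨a, -, h⟩
      rw [← h]
      exact Submodule.sum_mem _ fun v hv => Submodule.smul_mem _ _ (Submodule.subset_span hv)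
    obtain ⟨ε₁, h1, hε₁⟩ := (hfr.and_eventually self_mem_nhdsWithin).exists
    have hlt : ∀ᶠ ε : ℝ in nhdsWithin 0 (Ioi 0), ε < ε₁ :=
      nhdsWithin_le_nhds (eventually_lt_nhds hε₁)
    obtain ⟨ε₂, h2, hε₂⟩ := (hfr.and_eventually hlt).exists
    have hy : y ∈ Submodule.span ℝ (t : Set E) := by
      have h3 := Submodule.sub_mem _ (hmem _ h1) (hmem _ h2)
      have h4 : x + ε₁ • y - (x + ε₂ • y) = (ε₁ - ε₂) • y := by rw [sub_smul]; abel
      rw [h4] at h3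
      exact (Submodule.smul_mem_iff _ (sub_pos.2 hε₂).ne').1 h3
    have hxs : x ∈ Submodule.span ℝ (t : Set E) := by
      have := Submodule.sub_mem _ (hmem _ h1) (Submodule.smul_mem _ ε₁ hy)
      simpa using this
    obtain ⟨u, hu⟩ := (hF.indep ht).exists_dual
    have hxt : InCone t x := by
      obtain ⟨f, -, hf⟩ := Submodule.mem_span_finset.1 hxs
      refine inCone_of_dual_nonneg hu ⟨f, hf⟩ fun v hv => ?_
      have hcont : Filter.Tendsto (fun ε : ℝ => ⟪u v, x + ε • y⟫) (nhdsWithin 0 (Ioi 0))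
          (nhds ⟪u v, x⟫) := by
        have : Continuous fun ε : ℝ => ⟪u v, x + ε • y⟫ := by fun_prop
        have h := this.tendsto 0
        simp only [zero_smul, add_zero] at h
        exact h.mono_left nhdsWithin_le_nhds
      refine isClosed_Ici.mem_of_frequently_of_tendsto (hfr.mono ?_) hcont
      rintro ε ⟨a, ha, h⟩
      rw [mem_Ici, ← h, inner_dual_sum hu a hv]
      exact (ha v hv).le
    exact ⟨t, ht, hF.subset_of_inCone hs ht hsx hxt, hy⟩
  let T := (hF.finite.subset (Set.sep_subset F fun t => s ⊆ t)).toFinset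
  have hT : ∀ t, t ∈ T ↔ t ∈ F ∧ s ⊆ t := fun t => by simp [T]
  have htop : (⊤ : Subspace ℝ E) ∈ T.image fun t : Finset E => Submodule.span ℝ (t : Set E) := by
    refine Subspace.top_mem_of_biUnion_eq_univ (Set.eq_univ_of_forall fun y => ?_)
    obtain ⟨t, ht, hst, hy⟩ := key y
    simp only [Set.mem_iUnion]
    exact ⟨_, Finset.mem_image_of_mem _ ((hT t).2 ⟨ht, hst⟩), hy⟩
  obtain ⟨t, ht, htt⟩ := Finset.mem_image.1 htop
  obtain ⟨htF, hst⟩ := (hT t).1 ht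
  refine ⟨t, htF, hst, ?_⟩
  have h := finrank_span_finset_eq_card (R := ℝ) (s := t) (indep_iff.1 (hF.indep htF))
  rw [htt, finrank_top] at h
  exact h.symm

end Fan

/-! ### Derived subdivisions -/

section Derived

variable {E : Type*} [NormedAddCommGroup E] [InnerProductSpace ℝ E]

/-- `T` is a chain of nonempty faces of `F`. -/
def IsFaceChain (F : Set (Finset E)) (T : Finset (Finset E)) : Prop :=
  (∀ A ∈ T, A ∈ F ∧ A.Nonempty) ∧ ∀ A ∈ T, ∀ B ∈ T, A ⊆ B ∨ B ⊆ A

/-- `b` chooses a unit vector in the relative interior of each nonempty face. -/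
def IsCenter (F : Set (Finset E)) (b : Finset E → E) : Prop :=
  ∀ s ∈ F, s.Nonempty → PosComb s (b s) ∧ ‖b s‖ = 1

/-- The derived subdivision with centers `b`. -/
def derived [DecidableEq E] (F : Set (Finset E)) (b : Finset E → E) : Set (Finset E) :=
  {S | ∃ T, IsFaceChain F T ∧ S = T.image b}

lemma IsFaceChain.subset {F : Set (Finset E)} {T T' : Finset (Finset E)} (h : IsFaceChain F T)
    (hT : T' ⊆ T) : IsFaceChain F T' :=
  ⟨fun A hA => h.1 A (hT hA), fun A hA B hB => h.2 A (hT hA) B (hT hB)⟩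

variable [DecidableEq E] {F : Set (Finset E)} {b : Finset E → E}

lemma IsFaceChain.biUnion_mem {T : Finset (Finset E)} (h : IsFaceChain F T) (hT : T.Nonempty) :
    T.biUnion id ∈ T := by
  obtain ⟨M, hM, hmax⟩ := Finset.exists_max_image T Finset.card hT
  have : T.biUnion id = M := by
    refine subset_antisymm (Finset.biUnion_subset.2 fun A hA => ?_)
      (Finset.subset_biUnion_of_mem id hM)
    rcases h.2 A hA M hM with h1 | h1
    · exact h1
    · exact (Finset.eq_of_subset_of_card_le h1 (hmax A hA)).symm.subset
  rwa [this]

lemma IsFaceChain.biUnion_mem_fan (hF : IsFan F) {T : Finset (Finset E)} (h : IsFaceChain F T) :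
    T.biUnion id ∈ F := by
  rcases T.eq_empty_or_nonempty with rfl | hT
  · simpa using hF.empty_mem
  · exact (h.1 _ (h.biUnion_mem hT)).1

lemma IsFaceChain.posComb (hb : IsCenter F b) {T : Finset (Finset E)} (h : IsFaceChain F T)
    {a : Finset E → ℝ} (ha : ∀ A ∈ T, 0 < a A) :
    PosComb (T.biUnion id) (∑ A ∈ T, a A • b A) :=
  posComb_biUnion T id b a ha fun A hA => (hb A (h.1 A hA).1 (h.1 A hA).2).1

lemma IsCenter.injOn (hF : IsFan F) (hb : IsCenter F b) :
    Set.InjOn b {A | A ∈ F ∧ A.Nonempty} := fun A hA B hB hAB =>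
  hF.uniq A hA.1 B hB.1 (b A) (hb A hA.1 hA.2).1 (hAB ▸ (hb B hB.1 hB.2).1)

/-- A positive combination of centers over `T'` with the top weight reduced is never a positive
combination over `T` without its top. -/
lemma IsFaceChain.erase_top_ne (hF : IsFan F) (hb : IsCenter F b) {T T' : Finset (Finset E)}
    (hT : IsFaceChain F T) (hT' : IsFaceChain F T') {M : Finset E} (hM' : M ∈ T')
    (hMtop : T'.biUnion id = M) {a a' : Finset E → ℝ} (ha : ∀ A ∈ T, 0 < a A)
    (ha' : ∀ A ∈ T', 0 < a' A) {c : ℝ} (hc : c < a' M) :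
    ∑ A ∈ T.erase M, a A • b A ≠ (∑ A ∈ T', a' A • b A) - c • b M := by
  intro h
  have h1 := (hT.subset (Finset.erase_subset M T)).posComb hb (a := a)
    fun A hA => ha A (Finset.mem_of_mem_erase hA)
  have h2 := hT'.posComb hb (a := fun A => if A = M then a' A - c else a' A) fun A hA => by
    split_ifs with hAM
    · subst hAM; linarith
    · exact ha' A hA
  have h3 : ∑ A ∈ T', (if A = M then a' A - c else a' A) • b A
      = (∑ A ∈ T', a' A • b A) - c • b M := by
    rw [← Finset.add_sum_erase _ _ hM', ← Finset.add_sum_erase T' (fun A => a' A • b A) hM',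
      if_pos rfl, sub_smul, Finset.sum_congr rfl fun A hA => by
        rw [if_neg (Finset.ne_of_mem_erase hA)]]
    abel
  rw [h3, ← h, hMtop] at h2
  have h4 := hF.uniq _ ((hT.subset (Finset.erase_subset M T)).biUnion_mem_fan hF) M
    (hT'.1 M hM').1 _ h1 h2
  rcases (T.erase M).eq_empty_or_nonempty with h5 | h5
  · rw [h5] at h4
    exact (hT'.1 M hM').2.ne_empty (by simpa using h4.symm)
  · have h6 := (hT.subset (Finset.erase_subset M T)).biUnion_mem h5
    rw [h4] at h6
    exact Finset.notMem_erase M T h6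

lemma IsFaceChain.eq_of_sum_eq (hF : IsFan F) (hb : IsCenter F b) :
    ∀ (k : ℕ) {T T' : Finset (Finset E)}, T.card = k → IsFaceChain F T → IsFaceChain F T' →
      ∀ {a a' : Finset E → ℝ}, (∀ A ∈ T, 0 < a A) → (∀ A ∈ T', 0 < a' A) →
      ∑ A ∈ T, a A • b A = ∑ A ∈ T', a' A • b A → T = T' := by
  intro k
  induction k with
  | zero =>
    intro T T' hk hT hT' a a' ha ha' h
    rw [Finset.card_eq_zero] at hk
    subst hk
    by_contra hne
    have hne' : T'.Nonempty := Finset.nonempty_iff_ne_empty.2 (Ne.symm hne)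
    have h1 := hT'.posComb hb ha'
    rw [← h, Finset.sum_empty] at h1
    have h2 := hF.uniq _ (hT'.biUnion_mem_fan hF) ∅ hF.empty_mem 0 h1 (posComb_empty.2 rfl)
    exact (hT'.1 _ (hT'.biUnion_mem hne')).2.ne_empty h2
  | succ k ih =>
    intro T T' hk hT hT' a a' ha ha' h
    have hTne : T.Nonempty := Finset.card_pos.1 (by omega)
    have htop : T.biUnion id = T'.biUnion id := hF.uniq _ (hT.biUnion_mem_fan hF) _
      (hT'.biUnion_mem_fan hF) _ (hT.posComb hb ha) (h ▸ hT'.posComb hb ha')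
    set M := T.biUnion id with hM
    have hMT : M ∈ T := hT.biUnion_mem hTne
    have hT'ne : T'.Nonempty := by
      by_contra hcon
      rw [Finset.not_nonempty_iff_eq_empty.1 hcon] at htop
      exact (hT.1 M hMT).2.ne_empty (by simpa using htop)
    have hMT' : M ∈ T' := htop ▸ hT'.biUnion_mem hT'ne
    have e1 := Finset.sum_erase_eq_sub (f := fun A => a A • b A) hMT
    have e2 := Finset.sum_erase_eq_sub (f := fun A => a' A • b A) hMT'
    rcases lt_trichotomy (a M) (a' M) with hlt | heq | hgt
    · exact absurd (e1.trans (by rw [h])) (hT.erase_top_ne hF hb hT' hMT' htop.symm ha ha' hlt)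
    · have h1 : T.erase M = T'.erase M :=
        ih (by rw [Finset.card_erase_of_mem hMT, hk]; rfl) (hT.subset (Finset.erase_subset _ _))
          (hT'.subset (Finset.erase_subset _ _)) (fun A hA => ha A (Finset.mem_of_mem_erase hA))
          (fun A hA => ha' A (Finset.mem_of_mem_erase hA)) (by rw [e1, e2, h, heq])
      rw [← Finset.insert_erase hMT, h1, Finset.insert_erase hMT']
    · exact absurd (e2.trans (by rw [h])) (hT'.erase_top_ne hF hb hT hMT hM.symm ha' ha hgt)

lemma derived_isFan (hF : IsFan F) (hb : IsCenter F b) : IsFan (derived F b) where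
  finite := by
    have h1 : {T : Finset (Finset E) | (T : Set (Finset E)) ⊆ F}.Finite := by
      have := hF.finite.toFinset.powerset.finite_toSet
      refine this.subset fun T hT => ?_
      simpa [Set.subset_def, Finset.subset_iff] using hT
    refine (h1.image fun T => T.image b).subset ?_
    rintro S ⟨T, hT, rfl⟩
    exact ⟨T, fun A hA => (hT.1 A hA).1, rfl⟩
  empty_mem := ⟨∅, ⟨by simp, by simp⟩, by simp⟩
  unit := by
    rintro S ⟨T, hT, rfl⟩ v hv
    obtain ⟨A, hA, rfl⟩ := Finset.mem_image.1 hv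
    exact (hb A (hT.1 A hA).1 (hT.1 A hA).2).2
  down := by
    rintro S ⟨T, hT, rfl⟩ S' hS'
    refine ⟨T.filter fun A => b A ∈ S', hT.subset (Finset.filter_subset _ _), ?_⟩
    ext v
    simp only [Finset.mem_image, Finset.mem_filter]
    constructor
    · intro hv
      obtain ⟨A, hA, rfl⟩ := Finset.mem_image.1 (hS' hv)
      exact ⟨A, ⟨hA, hv⟩, rfl⟩
    · rintro ⟨A, ⟨_, hA⟩, rfl⟩; exact hA
  uniq := by
    rintro S ⟨T, hT, rfl⟩ S' ⟨T', hT', rfl⟩ x ⟨a, ha, hx⟩ ⟨a', ha', hx'⟩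
    rw [Finset.sum_image ((hb.injOn hF).mono fun A hA => hT.1 A hA)] at hx
    rw [Finset.sum_image ((hb.injOn hF).mono fun A hA => hT'.1 A hA)] at hx'
    rw [IsFaceChain.eq_of_sum_eq hF hb _ rfl hT hT' (a := fun A => a (b A))
      (a' := fun A => a' (b A)) (fun A hA => ha _ (Finset.mem_image_of_mem b hA))
      (fun A hA => ha' _ (Finset.mem_image_of_mem b hA)) (hx.trans hx'.symm)]

lemma exists_chain_sum_eq (hF : IsFan F) (hb : IsCenter F b) :
    ∀ (k : ℕ) {s : Finset E}, s.card = k → s ∈ F → ∀ {x : E}, PosComb s x →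
      ∃ T, IsFaceChain F T ∧ (∀ A ∈ T, A ⊆ s) ∧
        ∃ a : Finset E → ℝ, (∀ A ∈ T, 0 < a A) ∧ ∑ A ∈ T, a A • b A = x := by
  intro k
  induction k using Nat.strong_induction_on with
  | _ k ih =>
  intro s hk hs x hx
  rcases s.eq_empty_or_nonempty with rfl | hne
  · exact ⟨∅, ⟨by simp, by simp⟩, by simp, fun _ => 0, by simp, by simp [posComb_empty.1 hx]⟩
  obtain ⟨a, ha, rfl⟩ := hx
  obtain ⟨β, hβ, hβs⟩ := (hb s hs hne).1
  obtain ⟨v₀, hv₀, hmin⟩ := Finset.exists_min_image s (fun v => a v / β v) hne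
  set r := a v₀ / β v₀ with hr
  have hrpos : 0 < r := div_pos (ha _ hv₀) (hβ _ hv₀)
  have hcone : InCone (s.erase v₀) (∑ v ∈ s, a v • v - r • b s) := by
    refine ⟨fun v => a v - r * β v, fun v hv => ?_, ?_⟩
    · have hv' := Finset.mem_of_mem_erase hv
      have := hmin v hv'
      rw [le_div_iff₀ (hβ v hv')] at this
      linarith
    · have h0 : (a v₀ - r * β v₀) • v₀ = 0 := by
        rw [hr, div_mul_cancel₀ _ (hβ _ hv₀).ne', sub_self, zero_smul]
      rw [Finset.sum_erase s (f := fun v => (a v - r * β v) • v) h0,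
        ← hβs, Finset.smul_sum, ← Finset.sum_sub_distrib]
      simp [sub_smul, mul_smul]
  obtain ⟨s', hs', hx'⟩ := hcone.exists_posComb
  have hss : s' ⊆ s := hs'.trans (Finset.erase_subset _ _)
  have hcard : s'.card < k := by
    rw [← hk]
    exact (Finset.card_le_card hs').trans_lt (Finset.card_erase_lt_of_mem hv₀)
  obtain ⟨T, hT, hTs, c, hc, hcx⟩ := ih _ hcard rfl (hF.down s hs s' hss) hx'
  have hsT : s ∉ T := fun h => by
    have := Finset.card_le_card (hTs s h)
    omega
  refine ⟨insert s T, ⟨?_, ?_⟩, ?_, fun A => if A = s then r else c A, ?_, ?_⟩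
  · intro A hA
    rcases Finset.mem_insert.1 hA with rfl | h
    · exact ⟨hs, hne⟩
    · exact hT.1 A h
  · intro A hA B hB
    rcases Finset.mem_insert.1 hA with rfl | h
    · rcases Finset.mem_insert.1 hB with rfl | h'
      · exact Or.inl subset_rfl
      · exact Or.inr ((hTs B h').trans hss)
    · rcases Finset.mem_insert.1 hB with rfl | h'
      · exact Or.inl ((hTs A h).trans hss)
      · exact hT.2 A h B h'
  · intro A hA
    rcases Finset.mem_insert.1 hA with rfl | h
    · exact subset_rfl
    · exact (hTs A h).trans hss
  · intro A hA
    dsimp only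
    split_ifs with h
    · exact hrpos
    · exact hc A ((Finset.mem_insert.1 hA).resolve_left h)
  · rw [Finset.sum_insert hsT]
    beta_reduce
    rw [if_pos rfl, Finset.sum_congr rfl fun A hA => by
      rw [if_neg fun h : A = s => hsT (h ▸ hA)], hcx]
    abel

lemma derived_complete (hF : IsFan F) (hc : Complete F) (hb : IsCenter F b) :
    Complete (derived F b) := by
  intro x
  obtain ⟨s, hs, hx⟩ := hc x
  obtain ⟨T, hT, -, a, ha, rfl⟩ := exists_chain_sum_eq hF hb _ rfl hs hx
  refine ⟨T.image b, ⟨T, hT, rfl⟩, ?_⟩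
  have := posComb_biUnion T (fun A => {b A}) b a ha fun A _ => posComb_singleton (b A)
  rwa [Finset.biUnion_singleton] at this

lemma singleton_mem_derived {v : E} :
    {v} ∈ derived F b ↔ ∃ A ∈ F, A.Nonempty ∧ b A = v := by
  constructor
  · rintro ⟨T, hT, h⟩
    have hv : v ∈ T.image b := h ▸ Finset.mem_singleton_self v
    obtain ⟨A, hA, rfl⟩ := Finset.mem_image.1 hv
    exact ⟨A, (hT.1 A hA).1, (hT.1 A hA).2, rfl⟩
  · rintro ⟨A, hA, hne, rfl⟩
    exact ⟨{A}, ⟨by simp [hA, hne], by simp⟩, by simp⟩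

/-! ### Refinements and hyperplanes -/

/-- Every face of `F` lies in the cone over some face of `F₀`. -/
def Refines (F₀ F : Set (Finset E)) : Prop := ∀ S ∈ F, ∃ σ ∈ F₀, ∀ v ∈ S, InCone σ v

/-- The hyperplane orthogonal to `h` does not separate points of a face of `F`. -/
def Unsplit (F : Set (Finset E)) (h : E) : Prop :=
  ∀ S ∈ F, (∀ v ∈ S, 0 ≤ ⟪h, v⟫) ∨ ∀ v ∈ S, ⟪h, v⟫ ≤ 0

lemma IsFaceChain.inCone_top (hb : IsCenter F b) {T : Finset (Finset E)} (hT : IsFaceChain F T)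
    {A : Finset E} (hA : A ∈ T) : InCone (T.biUnion id) (b A) :=
  (hb A (hT.1 A hA).1 (hT.1 A hA).2).1.inCone.mono (Finset.subset_biUnion_of_mem id hA)

lemma derived_refines {F₀ : Set (Finset E)} (hF : IsFan F) (hb : IsCenter F b)
    (h : Refines F₀ F) : Refines F₀ (derived F b) := by
  rintro S ⟨T, hT, rfl⟩
  obtain ⟨σ, hσ, h1⟩ := h _ (hT.biUnion_mem_fan hF)
  refine ⟨σ, hσ, fun v hv => ?_⟩
  obtain ⟨A, hA, rfl⟩ := Finset.mem_image.1 hv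
  exact (hT.inCone_top hb hA).trans h1

lemma derived_unsplit {h : E} (hF : IsFan F) (hb : IsCenter F b) (hu : Unsplit F h) :
    Unsplit (derived F b) h := by
  rintro S ⟨T, hT, rfl⟩
  refine (hu _ (hT.biUnion_mem_fan hF)).imp ?_ ?_
  all_goals
    intro h1 v hv
    obtain ⟨A, hA, rfl⟩ := Finset.mem_image.1 hv
    obtain ⟨a, ha, hx⟩ := hT.inCone_top hb hA
    rw [← hx, inner_sum_smul]
  · exact Finset.sum_nonneg fun w hw => mul_nonneg (ha w hw) (h1 w hw)
  · exact Finset.sum_nonpos fun w hw => mul_nonpos_of_nonneg_of_nonpos (ha w hw) (h1 w hw)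

lemma PosComb.exists_inner_pos {s : Finset E} {x h : E} (hx : PosComb s x) (hp : 0 < ⟪h, x⟫) :
    ∃ v ∈ s, 0 < ⟪h, v⟫ := by
  by_contra! hcon
  obtain ⟨a, ha, rfl⟩ := hx
  rw [inner_sum_smul] at hp
  exact hp.not_ge (Finset.sum_nonpos fun v hv =>
    mul_nonpos_of_nonneg_of_nonpos (ha v hv).le (hcon v hv))

lemma PosComb.exists_inner_neg {s : Finset E} {x h : E} (hx : PosComb s x) (hp : ⟪h, x⟫ < 0) :
    ∃ v ∈ s, ⟪h, v⟫ < 0 := by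
  obtain ⟨v, hv, hv'⟩ := hx.exists_inner_pos (h := -h) (by rw [inner_neg_left]; linarith)
  exact ⟨v, hv, by rw [inner_neg_left] at hv'; linarith⟩

/-- A relative interior point of a cone on a hyperplane crossing it. -/
lemma exists_posComb_inner_eq_zero (s : Finset E) (h : E) (hp : ∃ v ∈ s, 0 < ⟪h, v⟫)
    (hn : ∃ v ∈ s, ⟪h, v⟫ < 0) : ∃ x, PosComb s x ∧ ⟪h, x⟫ = 0 := by
  set p := ∑ v ∈ s with 0 < ⟪h, v⟫, ⟪h, v⟫ with hpdef
  set q := ∑ v ∈ s with ⟪h, v⟫ < 0, -⟪h, v⟫ with hqdef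
  have hp' : 0 < p := by
    obtain ⟨v, hv, hv'⟩ := hp
    exact Finset.sum_pos (fun w hw => (Finset.mem_filter.1 hw).2)
      ⟨v, Finset.mem_filter.2 ⟨hv, hv'⟩⟩
  have hq' : 0 < q := by
    obtain ⟨v, hv, hv'⟩ := hn
    exact Finset.sum_pos (fun w hw => neg_pos.2 (Finset.mem_filter.1 hw).2)
      ⟨v, Finset.mem_filter.2 ⟨hv, hv'⟩⟩
  let a : E → ℝ := fun v => if 0 < ⟪h, v⟫ then q else if ⟪h, v⟫ < 0 then p else 1
  refine ⟨∑ v ∈ s, a v • v, ⟨a, fun v _ => ?_, rfl⟩, ?_⟩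
  · simp only [a]; split_ifs
    · exact hq'
    · exact hp'
    · exact one_pos
  · rw [inner_sum_smul]
    have h1 : ∀ v ∈ s, a v * ⟪h, v⟫ = q * (if 0 < ⟪h, v⟫ then ⟪h, v⟫ else 0)
        - p * (if ⟪h, v⟫ < 0 then -⟪h, v⟫ else 0) := by
      intro v _
      simp only [a]
      rcases lt_trichotomy ⟪h, v⟫ 0 with h1 | h1 | h1
      · simp [h1, h1.not_gt]
      · simp [h1]
      · simp [h1, h1.not_gt]
    rw [Finset.sum_congr rfl h1, Finset.sum_sub_distrib, ← Finset.mul_sum, ← Finset.mul_sum,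
      ← Finset.sum_filter, ← Finset.sum_filter, ← hpdef, ← hqdef, mul_comm, sub_self]

/-- Centers can be chosen on a given hyperplane whenever it crosses the face. -/
lemma exists_center_unsplit (hF : IsFan F) (h : E) :
    ∃ b, IsCenter F b ∧ Unsplit (derived F b) h := by
  have hex : ∀ s : Finset E, ∃ x, s ∈ F → s.Nonempty → PosComb s x ∧ ‖x‖ = 1 ∧
      ((∃ v ∈ s, 0 < ⟪h, v⟫) → (∃ v ∈ s, ⟪h, v⟫ < 0) → ⟪h, x⟫ = 0) := by
    intro s
    by_cases hs : s ∈ F ∧ s.Nonempty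
    swap
    · exact ⟨0, fun h1 h2 => absurd ⟨h1, h2⟩ hs⟩
    obtain ⟨hs, hne⟩ := hs
    have h1 : ∃ x, PosComb s x ∧ ((∃ v ∈ s, 0 < ⟪h, v⟫) → (∃ v ∈ s, ⟪h, v⟫ < 0) → ⟪h, x⟫ = 0) := by
      by_cases hcr : (∃ v ∈ s, 0 < ⟪h, v⟫) ∧ ∃ v ∈ s, ⟪h, v⟫ < 0
      · obtain ⟨x, hx, hx0⟩ := exists_posComb_inner_eq_zero s h hcr.1 hcr.2
        exact ⟨x, hx, fun _ _ => hx0⟩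
      · exact ⟨_, ⟨fun _ => 1, by simp, rfl⟩, fun h1 h2 => absurd ⟨h1, h2⟩ hcr⟩
    obtain ⟨x, hx, hx0⟩ := h1
    have hxne : x ≠ 0 := by
      rintro rfl
      exact hne.ne_empty (hF.uniq s hs ∅ hF.empty_mem 0 hx (posComb_empty.2 rfl))
    refine ⟨‖x‖⁻¹ • x, fun _ _ => ⟨hx.smul (inv_pos.2 (norm_pos_iff.2 hxne)), ?_, fun h1 h2 => ?_⟩⟩
    · exact norm_smul_inv_norm (𝕜 := ℝ) hxne
    · rw [real_inner_smul_right, hx0 h1 h2, mul_zero]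
  choose b hb using hex
  have hcb : IsCenter F b := fun s hs hne => ⟨(hb s hs hne).1, (hb s hs hne).2.1⟩
  refine ⟨b, hcb, ?_⟩
  rintro S ⟨T, hT, rfl⟩
  by_contra! hcon
  obtain ⟨⟨v, hv, hvn⟩, w, hw, hwp⟩ := hcon
  obtain ⟨A, hA, rfl⟩ := Finset.mem_image.1 hv
  obtain ⟨B, hB, rfl⟩ := Finset.mem_image.1 hw
  have hA' := hb A (hT.1 A hA).1 (hT.1 A hA).2
  have hB' := hb B (hT.1 B hB).1 (hT.1 B hB).2
  obtain ⟨v, hv, hv'⟩ := hA'.1.exists_inner_neg hvn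
  obtain ⟨w, hw, hw'⟩ := hB'.1.exists_inner_pos hwp
  rcases hT.2 A hA B hB with hAB | hAB
  · exact hwp.ne' (hB'.2.2 ⟨w, hw, hw'⟩ ⟨v, hAB hv, hv'⟩)
  · exact hvn.ne (hA'.2.2 ⟨w, hAB hw, hw'⟩ ⟨v, hv, hv'⟩)

end Derived

/-! ### Regularity of derived subdivisions -/

section Regular

variable {E : Type*} [NormedAddCommGroup E] [InnerProductSpace ℝ E] [FiniteDimensional ℝ E]
  [DecidableEq E] {F₀ F : Set (Finset E)} {b : Finset E → E}

/-- `ψ` defines a strictly convex piecewise linear function on each cone of `F₀`, whose domains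
of linearity are the cones of the refinement `F`. -/
def Reg (F₀ F : Set (Finset E)) (ψ : E → ℝ) : Prop :=
  ∀ S ∈ F, S.card = Module.finrank ℝ E → ∀ σ ∈ F₀, (∀ v ∈ S, InCone σ v) →
    ∃ ℓ : E, (∀ v ∈ S, ⟪ℓ, v⟫ = ψ v) ∧ ∀ v, {v} ∈ F → InCone σ v → v ∉ S → ⟪ℓ, v⟫ < ψ v

lemma IsFan.mem_of_inCone (hF : IsFan F) {σ : Finset E} (hσ : σ ∈ F) {v : E} (hv : {v} ∈ F)
    (h : InCone σ v) : v ∈ σ := by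
  simpa using hF.subset_of_inCone hv hσ (posComb_singleton v) h

lemma reg_self (hF : IsFan F) : Reg F F 0 := by
  intro S hS hSd σ hσ hSσ
  have h1 : S ⊆ σ := fun v hv => hF.mem_of_inCone hσ (hF.singleton_mem hS hv) (hSσ v hv)
  have h2 : S = σ := Finset.eq_of_subset_of_card_le h1 (hSd ▸ (hF.indep hσ).card_le)
  exact ⟨0, by simp, fun v hv hvσ hvS => absurd (h2 ▸ hF.mem_of_inCone hσ hv hvσ) hvS⟩

lemma IsFaceChain.image_indep (hF : IsFan F) (hb : IsCenter F b) {T : Finset (Finset E)}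
    (hT : IsFaceChain F T) : Indep (T.image b) :=
  (derived_isFan hF hb).indep ⟨T, hT, rfl⟩

lemma IsFaceChain.sum_image (hF : IsFan F) (hb : IsCenter F b) {T : Finset (Finset E)}
    (hT : IsFaceChain F T) (a : E → ℝ) :
    ∑ v ∈ T.image b, a v • v = ∑ B ∈ T, a (b B) • b B :=
  Finset.sum_image ((hb.injOn hF).mono fun _ hA => hT.1 _ hA)

lemma IsFaceChain.card_image (hF : IsFan F) (hb : IsCenter F b) {T : Finset (Finset E)}
    (hT : IsFaceChain F T) : (T.image b).card = T.card :=
  Finset.card_image_of_injOn ((hb.injOn hF).mono fun _ hA => hT.1 _ hA)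

lemma IsFaceChain.exists_new_vertex {T : Finset (Finset E)} (hT : IsFaceChain F T) {M : Finset E}
    (hM : M ∈ T) : ∃ u ∈ M, ∀ B ∈ T, B.card < M.card → u ∉ B := by
  set T' := T.filter fun B => B.card < M.card
  have hT' : IsFaceChain F T' := hT.subset (Finset.filter_subset _ _)
  by_contra! hcon
  have hsub : M ⊆ T'.biUnion id := fun u hu => by
    obtain ⟨B, hB, hBM, huB⟩ := hcon u hu
    exact Finset.mem_biUnion.2 ⟨B, Finset.mem_filter.2 ⟨hB, hBM⟩, huB⟩
  have hne : T'.Nonempty := by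
    obtain ⟨u, hu⟩ := (hT.1 M hM).2
    obtain ⟨B, hB, hBM, -⟩ := hcon u hu
    exact ⟨B, Finset.mem_filter.2 ⟨hB, hBM⟩⟩
  have h1 := (Finset.mem_filter.1 (hT'.biUnion_mem hne)).2
  exact h1.not_ge (Finset.card_le_card hsub)

/-- The center of a face inside the top of a full flag, but not in the flag, has a positive
leading coefficient, at a member of the flag of larger dimension. -/
lemma IsFaceChain.exists_expansion (hF : IsFan F) (hb : IsCenter F b) {T : Finset (Finset E)}
    (hT : IsFaceChain F T) (hcard : T.card = Module.finrank ℝ E) {A : Finset E} (hA : A ∈ F)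
    (hne : A.Nonempty) (hAT : A ⊆ T.biUnion id) (hAn : A ∉ T) :
    ∃ m : Finset E → ℝ, ∃ M ∈ T, A.card < M.card ∧ 0 < m M ∧
      (∀ B ∈ T, B ≠ M → m B ≠ 0 → B.card < M.card) ∧ b A = ∑ B ∈ T, m B • b B := by
  obtain ⟨m', hm'⟩ := (hT.image_indep hF hb).exists_sum_eq
    (by rw [hT.card_image hF hb, hcard]) (b A)
  rw [hT.sum_image hF hb] at hm'
  set m : Finset E → ℝ := fun B => m' (b B) with hm
  have hSF := hT.biUnion_mem_fan hF
  obtain ⟨u, hu⟩ := (hF.indep hSF).exists_dual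
  have hsupp : (T.filter fun B => m B ≠ 0).Nonempty := by
    by_contra hcon
    rw [Finset.not_nonempty_iff_eq_empty, Finset.filter_eq_empty_iff] at hcon
    have h0 : b A = 0 := by
      rw [← hm']
      refine Finset.sum_eq_zero fun B hB => ?_
      have := hcon hB
      simp only [ne_eq, not_not] at this
      rw [show m' (b B) = 0 from this, zero_smul]
    have := (hb A hA hne).2
    rw [h0, norm_zero] at this
    exact zero_ne_one this
  obtain ⟨M, hM, hmax⟩ := Finset.exists_max_image _ Finset.card hsupp
  obtain ⟨hMT, hmM⟩ := Finset.mem_filter.1 hM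
  have hlt : ∀ B ∈ T, B ≠ M → m B ≠ 0 → B.card < M.card := by
    intro B hB hBM hmB
    refine lt_of_le_of_ne (hmax B (Finset.mem_filter.2 ⟨hB, hmB⟩)) fun hc => hBM ?_
    rcases hT.2 B hB M hMT with h | h
    · exact Finset.eq_of_subset_of_card_le h hc.ge
    · exact (Finset.eq_of_subset_of_card_le h hc.le).symm
  have hcoef : ∀ v ∈ T.biUnion id, ∀ B ∈ F, B ⊆ T.biUnion id → ∀ c : E → ℝ,
      ∑ w ∈ B, c w • w = b B → ⟪u v, b B⟫ = if v ∈ B then c v else 0 := by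
    intro v hv B _ hB c hc
    rw [← hc, ← sum_smul_subset hB, inner_dual_sum hu _ hv]
  obtain ⟨c, hc, hcA⟩ := (hb A hA hne).1
  have hexp : ∀ v, ⟪u v, b A⟫ = ∑ B ∈ T, m B * ⟪u v, b B⟫ := fun v => by
    rw [← hm', inner_sum]; simp [inner_smul_right, hm]
  have hAM : A ⊆ M := by
    intro v hv
    by_contra hvM
    have h1 := hexp v
    rw [hcoef v (hAT hv) A hA hAT c hcA, if_pos hv, Finset.sum_eq_zero] at h1
    · exact (hc v hv).ne' h1
    · intro B hB
      by_cases hmB : m B = 0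
      · rw [hmB, zero_mul]
      obtain ⟨c', -, hcB⟩ := (hb B (hT.1 B hB).1 (hT.1 B hB).2).1
      rw [hcoef v (hAT hv) B (hT.1 B hB).1 (Finset.subset_biUnion_of_mem id hB) c' hcB, if_neg,
        mul_zero]
      intro hvB
      by_cases hBM : B = M
      · exact hvM (hBM ▸ hvB)
      · have hl := hlt B hB hBM hmB
        rcases hT.2 B hB M hMT with h | h
        · exact hvM (h hvB)
        · exact hl.not_ge (Finset.card_le_card h)
  refine ⟨m, M, hMT, ?_, ?_, hlt, hm'.symm⟩
  · exact Finset.card_lt_card (hAM.ssubset_of_ne fun h => hAn (h ▸ hMT))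
  · obtain ⟨w, hwM, hw⟩ := hT.exists_new_vertex hMT
    have hwS : w ∈ T.biUnion id := Finset.mem_biUnion.2 ⟨M, hMT, hwM⟩
    obtain ⟨β, hβ, hβM⟩ := (hb M (hT.1 M hMT).1 (hT.1 M hMT).2).1
    have h1 := hexp w
    rw [hcoef w hwS A hA hAT c hcA, Finset.sum_eq_single M] at h1
    · rw [hcoef w hwS M (hT.1 M hMT).1 (Finset.subset_biUnion_of_mem id hMT) β hβM,
        if_pos hwM] at h1
      have h2 : 0 ≤ m M * β w := by
        rw [← h1]; split_ifs with h
        · exact (hc w h).le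
        · exact le_rfl
      exact lt_of_le_of_ne (nonneg_of_mul_nonneg_left h2 (hβ w hwM)) (Ne.symm hmM)
    · intro B hB hBM
      by_cases hmB : m B = 0
      · rw [hmB, zero_mul]
      obtain ⟨c', -, hcB⟩ := (hb B (hT.1 B hB).1 (hT.1 B hB).2).1
      rw [hcoef w hwS B (hT.1 B hB).1 (Finset.subset_biUnion_of_mem id hB) c' hcB,
        if_neg (hw B hB (hlt B hB hBM hmB)), mul_zero]
    · exact fun h => absurd hMT h

lemma IsFaceChain.eventually_pow_lt (hF : IsFan F) (hb : IsCenter F b) {T : Finset (Finset E)}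
    (hT : IsFaceChain F T) (hcard : T.card = Module.finrank ℝ E) {A : Finset E} (hA : A ∈ F)
    (hne : A.Nonempty) (hAT : A ⊆ T.biUnion id) (hAn : A ∉ T) :
    ∀ᶠ R : ℝ in Filter.atTop, ∀ μ : E, (∀ B ∈ T, ⟪μ, b B⟫ = R ^ B.card) →
      R ^ A.card < ⟪μ, b A⟫ := by
  obtain ⟨m, M, hM, hAM, hmM, hlt, hexp⟩ := hT.exists_expansion hF hb hcard hA hne hAT hAn
  have ho : (fun R : ℝ => R ^ A.card - ∑ B ∈ T.erase M, m B * R ^ B.card)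
      =o[Filter.atTop] fun R : ℝ => R ^ M.card := by
    refine (Asymptotics.isLittleO_pow_pow_atTop_of_lt hAM).sub ?_
    refine Asymptotics.IsLittleO.fun_sum fun B hB => ?_
    by_cases hmB : m B = 0
    · simp only [hmB, zero_mul]; exact Asymptotics.isLittleO_zero _ _
    · exact (Asymptotics.isLittleO_pow_pow_atTop_of_lt (hlt B (Finset.mem_of_mem_erase hB)
        (Finset.ne_of_mem_erase hB) hmB)).const_mul_left _
  filter_upwards [ho.bound (half_pos hmM), Filter.eventually_gt_atTop 0] with R hR hR0 μ hμ
  have hpow : 0 < R ^ M.card := pow_pos hR0 _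
  rw [Real.norm_of_nonneg hpow.le] at hR
  have h1 := (le_abs_self _).trans hR
  have h2 : ⟪μ, b A⟫ = m M * R ^ M.card + ∑ B ∈ T.erase M, m B * R ^ B.card := by
    rw [hexp, inner_sum, ← Finset.add_sum_erase _ _ hM, inner_smul_right, hμ M hM]
    congr 1
    refine Finset.sum_congr rfl fun B hB => ?_
    rw [inner_smul_right, hμ B (Finset.mem_of_mem_erase hB)]
  rw [h2]
  nlinarith

lemma IsFan.finite_chains (hF : IsFan F) : {T | IsFaceChain F T}.Finite := by
  have := hF.finite.toFinset.powerset.finite_toSet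
  refine this.subset fun T hT => ?_
  simp only [Finset.coe_powerset, Set.mem_preimage, Set.mem_powerset_iff, Set.Finite.coe_toFinset]
  exact fun A hA => (hT.1 A hA).1

/-- Derived subdivisions preserve regularity. -/
lemma Reg.derived (hF₀ : IsFan F₀) (hF : IsFan F) (hr : Refines F₀ F) (hb : IsCenter F b)
    {ψ : E → ℝ} (hψ : Reg F₀ F ψ) : ∃ ψ', Reg F₀ (derived F b) ψ' := by
  have hc : ∀ A : Finset E, ∃ c : E → ℝ, A ∈ F → A.Nonempty →
      (∀ v ∈ A, 0 < c v) ∧ ∑ v ∈ A, c v • v = b A := by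
    intro A
    by_cases h : A ∈ F ∧ A.Nonempty
    · obtain ⟨c, hc⟩ := (hb A h.1 h.2).1
      exact ⟨c, fun _ _ => hc⟩
    · exact ⟨0, fun h1 h2 => absurd ⟨h1, h2⟩ h⟩
  choose c hc using hc
  set hh : Finset E → ℝ := fun A => ∑ v ∈ A, c A v * ψ v with hhdef
  have hR : ∀ᶠ R : ℝ in Filter.atTop, ∀ T ∈ {T | IsFaceChain F T}, ∀ A ∈ F,
      T.card = Module.finrank ℝ E → A.Nonempty → A ⊆ T.biUnion id → A ∉ T →
      ∀ μ : E, (∀ B ∈ T, ⟪μ, b B⟫ = R ^ B.card) → R ^ A.card < ⟪μ, b A⟫ := by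
    refine (Filter.eventually_all_finite hF.finite_chains).2 fun T hT =>
      (Filter.eventually_all_finite hF.finite).2 fun A hA => ?_
    by_cases h : T.card = Module.finrank ℝ E ∧ A.Nonempty ∧ A ⊆ T.biUnion id ∧ A ∉ T
    · filter_upwards [IsFaceChain.eventually_pow_lt hF hb hT h.1 hA h.2.1 h.2.2.1 h.2.2.2]
        with R hR _ _ _ _ using hR
    · exact Filter.Eventually.of_forall fun R h1 h2 h3 h4 => absurd ⟨h1, h2, h3, h4⟩ h
  obtain ⟨R, hR⟩ := hR.exists
  set g : E → Finset E := Function.invFunOn b {A | A ∈ F ∧ A.Nonempty} with hg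
  have hgb : ∀ A ∈ F, A.Nonempty → g (b A) = A := fun A hA hne =>
    (hb.injOn hF).leftInvOn_invFunOn ⟨hA, hne⟩
  have hμ : ∀ T : Finset (Finset E), ∃ μ : E, IsFaceChain F T →
      ∀ B ∈ T, ⟪μ, b B⟫ = R ^ B.card := by
    intro T
    by_cases hT : IsFaceChain F T
    · obtain ⟨μ, hμ⟩ := (hT.image_indep hF hb).exists_inner_eq fun v => R ^ (g v).card
      refine ⟨μ, fun _ B hB => ?_⟩
      rw [hμ _ (Finset.mem_image_of_mem b hB), hgb B (hT.1 B hB).1 (hT.1 B hB).2]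
    · exact ⟨0, fun h => absurd h hT⟩
  choose μ hμ using hμ
  have hinner : ∀ (ℓ : E) (A) (_ : A ∈ F) (_ : A.Nonempty), ⟪ℓ, b A⟫ = ∑ v ∈ A, c A v * ⟪ℓ, v⟫ :=
    fun ℓ A hA hne => by rw [← (hc A hA hne).2, inner_sum_smul]
  have hδ : ∀ᶠ δ : ℝ in nhdsWithin 0 (Ioi 0), ∀ T ∈ {T | IsFaceChain F T}, ∀ σ ∈ F₀,
      (T.biUnion id).card = Module.finrank ℝ E → (∀ v ∈ T.biUnion id, InCone σ v) →
      ∃ ℓ : E, (∀ v ∈ T.biUnion id, ⟪ℓ, v⟫ = ψ v) ∧ ∀ A ∈ F, A.Nonempty →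
        (∀ v ∈ A, InCone σ v) → ¬ A ⊆ T.biUnion id →
        ⟪ℓ, b A⟫ < hh A + δ * (⟪μ T, b A⟫ - R ^ A.card) := by
    refine (Filter.eventually_all_finite hF.finite_chains).2 fun T hT =>
      (Filter.eventually_all_finite hF₀.finite).2 fun σ hσ => ?_
    by_cases h : (T.biUnion id).card = Module.finrank ℝ E ∧ ∀ v ∈ T.biUnion id, InCone σ v
    swap
    · exact Filter.Eventually.of_forall fun δ h1 h2 => absurd ⟨h1, h2⟩ h
    obtain ⟨ℓ, hℓ, hℓ'⟩ := hψ _ (IsFaceChain.biUnion_mem_fan hF hT) h.1 σ hσ h.2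
    have : ∀ᶠ δ : ℝ in nhdsWithin 0 (Ioi 0), ∀ A ∈ F, A.Nonempty →
        (∀ v ∈ A, InCone σ v) → ¬ A ⊆ T.biUnion id →
        ⟪ℓ, b A⟫ < hh A + δ * (⟪μ T, b A⟫ - R ^ A.card) := by
      refine (Filter.eventually_all_finite hF.finite).2 fun A hA => ?_
      by_cases h' : A.Nonempty ∧ (∀ v ∈ A, InCone σ v) ∧ ¬ A ⊆ T.biUnion id
      swap
      · exact Filter.Eventually.of_forall fun δ h1 h2 h3 => absurd ⟨h1, h2, h3⟩ h'
      obtain ⟨hne, hAσ, hAT⟩ := h'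
      have hlt : ⟪ℓ, b A⟫ < hh A := by
        rw [hinner ℓ A hA hne]
        obtain ⟨w, hw, hwT⟩ := Finset.not_subset.1 hAT
        have hlt' : ∀ v ∈ A, v ∉ T.biUnion id → ⟪ℓ, v⟫ < ψ v := fun v hv hvT =>
          hℓ' v (hF.singleton_mem hA hv) (hAσ v hv) hvT
        refine Finset.sum_lt_sum (fun v hv => ?_)
          ⟨w, hw, mul_lt_mul_of_pos_left (hlt' w hw hwT) ((hc A hA hne).1 w hw)⟩
        refine mul_le_mul_of_nonneg_left ?_ ((hc A hA hne).1 v hv).le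
        by_cases hvT : v ∈ T.biUnion id
        · exact (hℓ v hvT).le
        · exact (hlt' v hv hvT).le
      have hcont : Continuous fun δ : ℝ => hh A + δ * (⟪μ T, b A⟫ - R ^ A.card) := by fun_prop
      have := (hcont.tendsto 0).eventually_const_lt (u := ⟪ℓ, b A⟫) (by simpa using hlt)
      filter_upwards [nhdsWithin_le_nhds this] with δ hδ _ _ _ using hδ
    filter_upwards [this] with δ hδ _ _ using ⟨ℓ, hℓ, hδ⟩
  obtain ⟨δ, hδ, hδ0⟩ := (hδ.and self_mem_nhdsWithin).exists
  replace hδ0 : 0 < δ := hδ0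
  refine ⟨fun v => hh (g v) - δ * R ^ (g v).card, ?_⟩
  rintro _ ⟨T, hT, rfl⟩ hcard σ hσ hTσ
  rw [hT.card_image hF hb] at hcard
  have htop : ∀ v ∈ T.biUnion id, InCone σ v := by
    rcases T.eq_empty_or_nonempty with rfl | hTne
    · simp
    obtain ⟨σ', hσ', h1⟩ := hr _ (hT.biUnion_mem_fan hF)
    have h2 := hT.1 _ (hT.biUnion_mem hTne)
    exact hF₀.inCone_of_posComb hσ hσ' h1 (hb _ h2.1 h2.2).1
      (hTσ _ (Finset.mem_image_of_mem b (hT.biUnion_mem hTne)))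
  have htopcard : (T.biUnion id).card = Module.finrank ℝ E := by
    refine le_antisymm (hF.indep (hT.biUnion_mem_fan hF)).card_le ?_
    rw [← hcard]
    have hinj : Set.InjOn Finset.card (T : Set (Finset E)) := by
      intro A hA B hB hAB
      rcases hT.2 A hA B hB with h | h
      · exact Finset.eq_of_subset_of_card_le h hAB.ge
      · exact (Finset.eq_of_subset_of_card_le h hAB.le).symm
    rw [← Finset.card_image_of_injOn hinj]
    refine (Finset.card_le_card (t := Finset.Icc 1 (T.biUnion id).card) ?_).trans (by simp)
    intro k hk
    obtain ⟨A, hA, rfl⟩ := Finset.mem_image.1 hk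
    exact Finset.mem_Icc.2 ⟨(hT.1 A hA).2.card_pos,
      Finset.card_le_card (Finset.subset_biUnion_of_mem id hA)⟩
  obtain ⟨ℓ, hℓ, hℓ'⟩ := hδ T hT σ hσ htopcard htop
  have heq : ∀ A ∈ F, A.Nonempty → A ⊆ T.biUnion id → ⟪ℓ, b A⟫ = hh A := by
    intro A hA hne hAT
    rw [hinner ℓ A hA hne]
    exact Finset.sum_congr rfl fun v hv => by rw [hℓ v (hAT hv)]
  refine ⟨ℓ - δ • μ T, ?_, ?_⟩
  · intro v hv
    obtain ⟨A, hA, rfl⟩ := Finset.mem_image.1 hv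
    have hA' := hT.1 A hA
    beta_reduce
    rw [inner_sub_left, real_inner_smul_left, hgb A hA'.1 hA'.2, hμ T hT A hA,
      heq A hA'.1 hA'.2 (Finset.subset_biUnion_of_mem id hA)]
  · intro v hv hvσ hvT
    obtain ⟨A, hA, hne, rfl⟩ := singleton_mem_derived.1 hv
    have hAT : A ∉ T := fun h => hvT (Finset.mem_image_of_mem b h)
    obtain ⟨σ', hσ', h1⟩ := hr A hA
    have hAσ := hF₀.inCone_of_posComb hσ hσ' h1 (hb A hA hne).1 hvσ
    beta_reduce
    rw [inner_sub_left, real_inner_smul_left, hgb A hA hne]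
    by_cases hsub : A ⊆ T.biUnion id
    · have h2 := hR T hT A hA hcard hne hsub hAT (μ T) (hμ T hT)
      rw [heq A hA hne hsub]
      have := mul_lt_mul_of_pos_left h2 hδ0
      linarith
    · have := hℓ' A hA hne hAσ hsub
      linarith

end Regular

/-! ### Derived subdivisions are eventually boundaries of convex polytopes -/

section Convex

variable {E : Type*} [NormedAddCommGroup E] [InnerProductSpace ℝ E]

/-- `S` is the set of points of `V` at which some linear functional bounded by `ω` is tight. -/
def Tight (V : Finset E) (ω : E → ℝ) (S : Finset E) : Prop :=
  S ⊆ V ∧ ∃ ℓ : E, (∀ v ∈ S, ⟪ℓ, v⟫ = ω v) ∧ ∀ v ∈ V, v ∉ S → ⟪ℓ, v⟫ < ω v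

/-- `F` is the fan over the boundary of the convex hull of the points `v / f v`. -/
def Supported (F : Set (Finset E)) (f : E → ℝ) : Prop :=
  (∀ v, {v} ∈ F → 0 < f v) ∧ ∀ S ∈ F, S.card = Module.finrank ℝ E →
    ∃ ℓ : E, (∀ v ∈ S, ⟪ℓ, v⟫ = f v) ∧ ∀ v, {v} ∈ F → v ∉ S → ⟪ℓ, v⟫ < f v

/-- `F'` is an `s`-fold derived subdivision of `F`. -/
def IterDerived [DecidableEq E] : ℕ → Set (Finset E) → Set (Finset E) → Prop
  | 0, F', F => F' = F
  | s + 1, F', F => ∃ F'' b, IterDerived s F'' F ∧ IsFan F'' ∧ IsCenter F'' b ∧ F' = derived F'' b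

/-- `u` is dual to `s`. -/
def IsDual (s : Finset E) (u : E → E) : Prop :=
  ∀ v ∈ s, ∀ w ∈ s, ⟪u v, w⟫ = if v = w then 1 else 0

lemma IsFan.finite_verts {F : Set (Finset E)} (hF : IsFan F) : {v | {v} ∈ F}.Finite :=
  hF.finite.preimage fun _ _ _ _ h => Finset.singleton_injective h

variable [FiniteDimensional ℝ E] [DecidableEq E] {F₀ F : Set (Finset E)}

lemma Reg.exists_supported (hF₀ : IsFan F₀) (hc₀ : Complete F₀) (hF : IsFan F)
    (hr : Refines F₀ F) {ψ : E → ℝ} (hψ : Reg F₀ F ψ) {H : Finset E}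
    (hH : ∀ h ∈ H, Unsplit F h)
    (hdual : ∀ σ ∈ F₀, σ.card = Module.finrank ℝ E → ∃ u : E → E,
      IsDual σ u ∧ ∀ v ∈ σ, u v ∈ H) :
    ∃ f, Supported F f := by
  set φ : E → ℝ := fun x => ∑ h ∈ H, |⟪h, x⟫| with hφ
  have hφpos : ∀ v, {v} ∈ F → 0 < φ v := by
    intro v hv
    obtain ⟨σ, hσ, -, hσd⟩ := hF₀.exists_facet hc₀ hF₀.empty_mem
    obtain ⟨u, hu, huH⟩ := hdual σ hσ hσd
    obtain ⟨a, ha⟩ := (hF₀.indep hσ).exists_sum_eq hσd v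
    have hv0 : v ≠ 0 := hF.ne_zero hv (Finset.mem_singleton_self v)
    have : ∃ w ∈ σ, ⟪u w, v⟫ ≠ 0 := by
      by_contra! hcon
      refine hv0 (ha ▸ Finset.sum_eq_zero fun w hw => ?_)
      rw [← inner_dual_sum hu a hw, ha, hcon w hw, zero_smul]
    obtain ⟨w, hw, hwv⟩ := this
    exact Finset.sum_pos' (fun _ _ => abs_nonneg _) ⟨u w, huH w hw, abs_pos.2 hwv⟩
  have hlin : ∀ S ∈ F, ∃ ℓ : E, (∀ x, ⟪ℓ, x⟫ ≤ φ x) ∧ (∀ x ∈ S, ⟪ℓ, x⟫ = φ x) ∧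
      ∀ x, (∃ h ∈ H, ⟪h, x⟫ < 0 ∧ ∀ v ∈ S, 0 ≤ ⟪h, v⟫) → ⟪ℓ, x⟫ < φ x := by
    intro S hS
    let sg : E → ℝ := fun h => if ∀ v ∈ S, 0 ≤ ⟪h, v⟫ then 1 else -1
    have hin : ∀ x, ⟪∑ h ∈ H, sg h • h, x⟫ = ∑ h ∈ H, sg h * ⟪h, x⟫ := fun x => by
      simp [sum_inner, real_inner_smul_left]
    have hle : ∀ h x, sg h * ⟪h, x⟫ ≤ |⟪h, x⟫| := fun h x => by
      simp only [sg]; split_ifs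
      · rw [one_mul]; exact le_abs_self _
      · rw [neg_one_mul]; exact neg_le_abs _
    refine ⟨∑ h ∈ H, sg h • h, fun x => ?_, fun x hx => ?_, fun x hx => ?_⟩
    · rw [hin]; exact Finset.sum_le_sum fun h _ => hle h x
    · rw [hin]
      refine Finset.sum_congr rfl fun h hh => ?_
      simp only [sg]; split_ifs with h1
      · rw [abs_of_nonneg (h1 x hx), one_mul]
      · rw [abs_of_nonpos (((hH h hh S hS).resolve_left h1) x hx), neg_one_mul]
    · rw [hin]
      obtain ⟨h, hh, hneg, hnn⟩ := hx
      refine Finset.sum_lt_sum (fun h _ => hle h x) ⟨h, hh, ?_⟩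
      simp only [sg]
      rw [if_pos hnn, one_mul]
      exact hneg.trans_le (abs_nonneg _)
  have hev : ∀ᶠ ε : ℝ in nhdsWithin 0 (Ioi 0), ∀ S ∈ F, S.card = Module.finrank ℝ E →
      ∃ ℓ : E, (∀ v ∈ S, ⟪ℓ, v⟫ = φ v + ε * ψ v) ∧
        ∀ v ∈ {v | {v} ∈ F}, v ∉ S → ⟪ℓ, v⟫ < φ v + ε * ψ v := by
    refine (Filter.eventually_all_finite hF.finite).2 fun S hS => ?_
    by_cases hSd : S.card = Module.finrank ℝ E
    swap
    · exact Filter.Eventually.of_forall fun ε h => absurd h hSd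
    obtain ⟨σ₁, hσ₁, hSσ₁⟩ := hr S hS
    obtain ⟨σ, hσ, hσσ, hσd⟩ := hF₀.exists_facet hc₀ hσ₁
    have hSσ : ∀ v ∈ S, InCone σ v := fun v hv => (hSσ₁ v hv).mono hσσ
    obtain ⟨ℓ, hℓ, hℓ'⟩ := hψ S hS hSd σ hσ hSσ
    obtain ⟨lam, h1, h2, h3⟩ := hlin S hS
    obtain ⟨u, hu, huH⟩ := hdual σ hσ hσd
    have hstrict : ∀ v, ¬ InCone σ v → ⟪lam, v⟫ < φ v := by
      intro v hv
      refine h3 v ?_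
      by_contra! hcon
      refine hv (inCone_of_dual_nonneg hu ((hF₀.indep hσ).exists_sum_eq hσd v) fun w hw => ?_)
      by_contra hneg
      obtain ⟨x, hx, hx'⟩ := hcon (u w) (huH w hw) (not_le.1 hneg)
      obtain ⟨a, ha, rfl⟩ := hSσ x hx
      rw [inner_dual_sum hu a hw] at hx'
      exact hx'.not_ge (ha w hw)
    have : ∀ᶠ ε : ℝ in nhdsWithin 0 (Ioi 0), ∀ v ∈ {v | {v} ∈ F}, v ∉ S →
        ⟪lam + ε • ℓ, v⟫ < φ v + ε * ψ v := by
      refine (Filter.eventually_all_finite hF.finite_verts).2 fun v hv => ?_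
      by_cases hvσ : InCone σ v
      · filter_upwards [self_mem_nhdsWithin] with ε hε hvS
        rw [inner_add_left, real_inner_smul_left]
        exact add_lt_add_of_le_of_lt (h1 v)
          (mul_lt_mul_of_pos_left (hℓ' v hv hvσ hvS) hε)
      · have hcont : Continuous fun ε : ℝ => φ v + ε * ψ v - ⟪lam + ε • ℓ, v⟫ := by fun_prop
        have := (hcont.tendsto 0).eventually_const_lt (u := 0) (by simpa using hstrict v hvσ)
        filter_upwards [nhdsWithin_le_nhds this] with ε hε _
        linarith
    filter_upwards [this] with ε hε _
    exact ⟨lam + ε • ℓ, fun v hv => by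
      rw [inner_add_left, real_inner_smul_left, h2 v hv, hℓ v hv], hε⟩
  have hpos : ∀ᶠ ε : ℝ in nhdsWithin 0 (Ioi 0), ∀ v ∈ {v | {v} ∈ F}, 0 < φ v + ε * ψ v := by
    refine (Filter.eventually_all_finite hF.finite_verts).2 fun v hv => ?_
    have hcont : Continuous fun ε : ℝ => φ v + ε * ψ v := by fun_prop
    exact nhdsWithin_le_nhds
      ((hcont.tendsto 0).eventually_const_lt (u := 0) (by simpa using hφpos v hv))
  obtain ⟨ε, h1, h2⟩ := (hev.and hpos).exists
  exact ⟨fun v => φ v + ε * ψ v, h2, h1⟩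

lemma exists_iterDerived (hF : IsFan F) (hc : Complete F) (L : List E) :
    ∃ F', IterDerived L.length F' F ∧ IsFan F' ∧ Complete F' ∧ Refines F F' ∧
      (∃ ψ, Reg F F' ψ) ∧ ∀ h ∈ L, Unsplit F' h := by
  induction L with
  | nil => exact ⟨F, rfl, hF, hc, fun S hS => ⟨S, hS, fun v => inCone_self⟩, ⟨0, reg_self hF⟩,
      by simp⟩
  | cons h L ih =>
    obtain ⟨F', h1, h2, h3, h4, ⟨ψ, h5⟩, h6⟩ := ih
    obtain ⟨b, hb, hu⟩ := exists_center_unsplit h2 h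
    refine ⟨derived F' b, ⟨F', b, h1, h2, hb, rfl⟩, derived_isFan h2 hb, derived_complete h2 h3 hb,
      derived_refines h2 hb h4, h5.derived hF h2 h4 hb, fun k hk => ?_⟩
    rcases List.mem_cons.1 hk with rfl | hk
    · exact hu
    · exact derived_unsplit h2 hb (h6 k hk)

/-- Two complete fans have derived subdivisions of the same depth, each of which is the fan over
the boundary of a convex polytope. -/
lemma exists_common_supported {F₁ F₂ : Set (Finset E)} (hF₁ : IsFan F₁) (hc₁ : Complete F₁)
    (hF₂ : IsFan F₂) (hc₂ : Complete F₂) : ∃ s B₁ B₂, IterDerived s B₁ F₁ ∧ IterDerived s B₂ F₂ ∧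
      (IsFan B₁ ∧ Complete B₁ ∧ ∃ f, Supported B₁ f) ∧
      (IsFan B₂ ∧ Complete B₂ ∧ ∃ f, Supported B₂ f) := by
  have hdual : ∀ σ : Finset E, ∃ u : E → E, Indep σ → IsDual σ u := by
    intro σ
    by_cases h : Indep σ
    · obtain ⟨u, hu⟩ := h.exists_dual
      exact ⟨u, fun _ => hu⟩
    · exact ⟨0, fun h' => absurd h' h⟩
  choose u hu using hdual
  set H : Finset E := (hF₁.finite.union hF₂.finite).toFinset.biUnion fun σ => σ.image (u σ) with hH
  have hmem : ∀ σ ∈ F₁ ∪ F₂, ∀ v ∈ σ, u σ v ∈ H.toList := fun σ hσ v hv => by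
    rw [Finset.mem_toList]
    exact Finset.mem_biUnion.2 ⟨σ, by simpa using hσ, Finset.mem_image_of_mem _ hv⟩
  obtain ⟨B₁, h1, h2, h3, h4, ⟨ψ, h5⟩, h6⟩ := exists_iterDerived hF₁ hc₁ H.toList
  obtain ⟨B₂, k1, k2, k3, k4, ⟨ψ', k5⟩, k6⟩ := exists_iterDerived hF₂ hc₂ H.toList
  refine ⟨_, B₁, B₂, h1, k1, ⟨h2, h3, ?_⟩, k2, k3, ?_⟩
  · exact h5.exists_supported hF₁ hc₁ h2 h4 (fun h hh => h6 h (Finset.mem_toList.2 hh))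
      fun σ hσ _ => ⟨u σ, hu σ (hF₁.indep hσ),
        fun v hv => Finset.mem_toList.1 (hmem σ (Or.inl hσ) v hv)⟩
  · exact k5.exists_supported hF₂ hc₂ k2 k4 (fun h hh => k6 h (Finset.mem_toList.2 hh))
      fun σ hσ _ => ⟨u σ, hu σ (hF₂.indep hσ),
        fun v hv => Finset.mem_toList.1 (hmem σ (Or.inr hσ) v hv)⟩

end Convex

/-! ### Tight sets -/

section TightSets

variable {E : Type*} [NormedAddCommGroup E] [InnerProductSpace ℝ E]

lemma Tight.le {V S : Finset E} {ω : E → ℝ} (h : Tight V ω S) :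
    ∃ ℓ : E, (∀ v ∈ S, ⟪ℓ, v⟫ = ω v) ∧ (∀ v ∈ V, v ∉ S → ⟪ℓ, v⟫ < ω v) ∧
      ∀ v ∈ V, ⟪ℓ, v⟫ ≤ ω v := by
  obtain ⟨-, ℓ, h1, h2⟩ := h
  refine ⟨ℓ, h1, h2, fun v hv => ?_⟩
  by_cases hvS : v ∈ S
  · exact (h1 v hvS).le
  · exact (h2 v hv hvS).le

lemma exists_tight_of_le {V S : Finset E} {ω : E → ℝ} (hS : S ⊆ V) {ℓ : E}
    (h1 : ∀ v ∈ S, ⟪ℓ, v⟫ = ω v) (h2 : ∀ v ∈ V, ⟪ℓ, v⟫ ≤ ω v) :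
    ∃ S', S ⊆ S' ∧ Tight V ω S' := by
  refine ⟨V.filter fun v => ⟪ℓ, v⟫ = ω v, fun v hv => Finset.mem_filter.2 ⟨hS hv, h1 v hv⟩,
    Finset.filter_subset _ _, ℓ, fun v hv => (Finset.mem_filter.1 hv).2, fun v hv hvn => ?_⟩
  exact lt_of_le_of_ne (h2 v hv) fun h => hvn (Finset.mem_filter.2 ⟨hv, h⟩)

lemma Tight.subset_of_inCone {V S T : Finset E} {ω : E → ℝ} (hS : Tight V ω S)
    (hT : Tight V ω T) {x : E} (hx : PosComb S x) (hxT : InCone T x) : S ⊆ T := by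
  obtain ⟨ℓ, h1, -, h3⟩ := hS.le
  obtain ⟨ℓ', k1, k2, k3⟩ := hT.le
  obtain ⟨a, ha, hax⟩ := hx
  obtain ⟨c, hc, hcx⟩ := hxT
  by_contra hST
  obtain ⟨w, hw, hwT⟩ := Finset.not_subset.1 hST
  have e1 : ⟪ℓ, x⟫ = ∑ v ∈ S, a v * ω v := by
    rw [← hax, inner_sum_smul]; exact Finset.sum_congr rfl fun v hv => by rw [h1 v hv]
  have e2 : ⟪ℓ', x⟫ < ∑ v ∈ S, a v * ω v := by
    rw [← hax, inner_sum_smul]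
    exact Finset.sum_lt_sum
      (fun v hv => mul_le_mul_of_nonneg_left (k3 v (hS.1 hv)) (ha v hv).le)
      ⟨w, hw, mul_lt_mul_of_pos_left (k2 w (hS.1 hw) hwT) (ha w hw)⟩
  have e3 : ⟪ℓ', x⟫ = ∑ v ∈ T, c v * ω v := by
    rw [← hcx, inner_sum_smul]; exact Finset.sum_congr rfl fun v hv => by rw [k1 v hv]
  have e4 : ⟪ℓ, x⟫ ≤ ∑ v ∈ T, c v * ω v := by
    rw [← hcx, inner_sum_smul]
    exact Finset.sum_le_sum fun v hv => mul_le_mul_of_nonneg_left (h3 v (hT.1 hv)) (hc v hv)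
  linarith

lemma tight_empty {V : Finset E} {ω : E → ℝ} (h : ∀ v ∈ V, 0 < ω v) : Tight V ω ∅ :=
  ⟨Finset.empty_subset _, 0, by simp, fun v hv _ => by simpa using h v hv⟩

variable [FiniteDimensional ℝ E]

lemma Tight.subset {V S T : Finset E} {ω : E → ℝ} (h : Tight V ω S) (hi : Indep S)
    (hT : T ⊆ S) : Tight V ω T := by
  obtain ⟨hSV, ℓ, h1, h2⟩ := h
  obtain ⟨ν, hν⟩ := hi.exists_inner_eq fun v => if v ∈ T then 0 else 1
  have hev : ∀ᶠ ε : ℝ in nhdsWithin 0 (Ioi 0), ∀ v ∈ (V : Set E), v ∉ S →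
      ⟪ℓ - ε • ν, v⟫ < ω v := by
    refine (Filter.eventually_all_finite V.finite_toSet).2 fun v hv => ?_
    by_cases hvS : v ∈ S
    · exact Filter.Eventually.of_forall fun _ h => absurd hvS h
    have hcont : Continuous fun ε : ℝ => ⟪ℓ - ε • ν, v⟫ := by fun_prop
    filter_upwards [nhdsWithin_le_nhds ((hcont.tendsto 0).eventually_lt_const (u := ω v)
      (by simpa using h2 v hv hvS))] with ε hε _ using hε
  obtain ⟨ε, hε, hε0⟩ := (hev.and self_mem_nhdsWithin).exists
  replace hε0 : 0 < ε := hε0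
  refine ⟨hT.trans hSV, ℓ - ε • ν, fun v hv => ?_, fun v hv hvT => ?_⟩
  · rw [inner_sub_left, real_inner_smul_left, hν v (hT hv), if_pos hv, h1 v (hT hv)]; ring
  · by_cases hvS : v ∈ S
    · rw [inner_sub_left, real_inner_smul_left, hν v hvS, if_neg hvT, h1 v hvS]; linarith
    · exact hε v hv hvS

/-- If all tight sets are independent, they form a fan. -/
lemma tight_isFan {V : Finset E} {ω : E → ℝ} (hV : ∀ v ∈ V, ‖v‖ = 1) (hω : ∀ v ∈ V, 0 < ω v)
    (hi : ∀ S, Tight V ω S → Indep S) : IsFan {S | Tight V ω S} where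
  finite := V.powerset.finite_toSet.subset fun S hS => by simpa using hS.1
  empty_mem := tight_empty hω
  unit S hS v hv := hV v (hS.1 hv)
  down S hS T hT := Tight.subset hS (hi S hS) hT
  uniq S hS T hT x hx hx' := subset_antisymm (Tight.subset_of_inCone hS hT hx hx'.inCone)
    (Tight.subset_of_inCone hT hS hx' hx.inCone)

end TightSets

section Families

variable {E : Type*} [NormedAddCommGroup E] [InnerProductSpace ℝ E] [FiniteDimensional ℝ E]
  {V : Finset E} {ω : ℝ → E → ℝ}

lemma Tight.eventually {X : Type*} [TopologicalSpace X] {ω : X → E → ℝ}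
    (hcont : ∀ v, Continuous fun t => ω t v) {S : Finset E} {t : X}
    (h : Tight V (ω t) S) (hi : Indep S) : ∀ᶠ s in nhds t, Tight V (ω s) S := by
  obtain ⟨hSV, ℓ, h1, h2⟩ := h
  obtain ⟨u, hu⟩ := hi.exists_dual
  set L : X → E := fun s => ℓ + ∑ v ∈ S, (ω s v - ω t v) • u v with hL
  have hLc : Continuous L := by fun_prop
  have hLt : L t = ℓ := by simp [hL]
  have hev : ∀ᶠ s in nhds t, ∀ v ∈ (V : Set E), v ∉ S → ⟪L s, v⟫ < ω s v := by
    refine (Filter.eventually_all_finite V.finite_toSet).2 fun v hv => ?_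
    by_cases hvS : v ∈ S
    · exact Filter.Eventually.of_forall fun _ h => absurd hvS h
    have hc : Continuous fun s => ω s v - ⟪L s, v⟫ := by fun_prop
    filter_upwards [(hc.tendsto t).eventually_const_lt (u := 0)
      (by rw [hLt]; linarith [h2 v hv hvS])] with s hs _
    linarith
  filter_upwards [hev] with s hs
  refine ⟨hSV, L s, fun v hv => ?_, hs⟩
  rw [hL, inner_add_left, inner_sum_dual hu (fun v => ω s v - ω t v) hv, h1 v hv]
  ring

lemma exists_norm_bound (hcont : ∀ v, Continuous fun t => ω t v) (hV : ∀ x, InCone V x) (t : ℝ) :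
    ∃ C, ∀ᶠ s in nhds t, ∀ ℓ : E, (∀ v ∈ V, ⟪ℓ, v⟫ ≤ ω s v) → ‖ℓ‖ ≤ C := by
  let e := stdOrthonormalBasis ℝ E
  choose a ha hax using hV
  set C : E → ℝ → ℝ := fun x s => ∑ v ∈ V, a x v * ω s v with hC
  have hCc : ∀ x, Continuous (C x) := fun x => by fun_prop
  have hb : ∀ s (ℓ : E), (∀ v ∈ V, ⟪ℓ, v⟫ ≤ ω s v) → ∀ x, ⟪ℓ, x⟫ ≤ C x s := by
    intro s ℓ hℓ x
    conv_lhs => rw [← hax x]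
    rw [inner_sum_smul]
    exact Finset.sum_le_sum fun v hv => mul_le_mul_of_nonneg_left (hℓ v hv) (ha x v hv)
  refine ⟨∑ i, (|C (e i) t| + |C (-e i) t| + 1), ?_⟩
  have hev : ∀ x, ∀ᶠ s in nhds t, C x s < C x t + 1 := fun x =>
    ((hCc x).tendsto t).eventually_lt_const (by linarith)
  filter_upwards [Filter.eventually_all.2 fun i => hev (e i),
    Filter.eventually_all.2 fun i => hev (-e i)] with s hs hs' ℓ hℓ
  rw [← e.sum_repr' ℓ]
  refine (norm_sum_le _ _).trans (Finset.sum_le_sum fun i _ => ?_)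
  rw [norm_smul, e.orthonormal.1 i, mul_one, Real.norm_eq_abs, real_inner_comm, abs_le]
  have h1 := hb s ℓ hℓ (e i)
  have h2 := hb s ℓ hℓ (-e i)
  rw [inner_neg_right] at h2
  have := hs i
  have := hs' i
  have := le_abs_self (C (e i) t)
  have := le_abs_self (C (-e i) t)
  have := abs_nonneg (C (e i) t)
  have := abs_nonneg (C (-e i) t)
  constructor <;> linarith

lemma eventually_tight_subset (hcont : ∀ v, Continuous fun t => ω t v) (hV : ∀ x, InCone V x)
    (t : ℝ) : ∀ᶠ s in nhds t, ∀ S, Tight V (ω s) S → ∃ S', S ⊆ S' ∧ Tight V (ω t) S' := by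
  obtain ⟨C, hC⟩ := exists_norm_bound hcont hV t
  have key : ∀ S ∈ (V.powerset : Set (Finset E)), ∀ᶠ s in nhds t, Tight V (ω s) S →
      ∃ S', S ⊆ S' ∧ Tight V (ω t) S' := by
    intro S hS
    by_cases hex : ∃ S', S ⊆ S' ∧ Tight V (ω t) S'
    · exact Filter.Eventually.of_forall fun _ _ => hex
    have hSV : S ⊆ V := by simpa using hS
    have hcpt : ∀ᶠ s in nhds t, ∀ ℓ ∈ Metric.closedBall (0 : E) C,
        ¬ ((∀ v ∈ S, ⟪ℓ, v⟫ = ω s v) ∧ ∀ v ∈ V, ⟪ℓ, v⟫ ≤ ω s v) := by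
      refine (isCompact_closedBall (0 : E) C).eventually_forall_of_forall_eventually fun ℓ _ => ?_
      have hn : ¬ ((∀ v ∈ S, ⟪ℓ, v⟫ = ω t v) ∧ ∀ v ∈ V, ⟪ℓ, v⟫ ≤ ω t v) := fun h =>
        hex (exists_tight_of_le hSV h.1 h.2)
      have hclosed : IsClosed {z : ℝ × E |
          (∀ v ∈ S, ⟪z.2, v⟫ = ω z.1 v) ∧ ∀ v ∈ V, ⟪z.2, v⟫ ≤ ω z.1 v} := by
        have hc' : ∀ v, Continuous fun z : ℝ × E => ω z.1 v := fun v =>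
          (hcont v).comp continuous_fst
        simp only [Set.ofPred_and, Set.ofPred_forall]
        refine IsClosed.inter ?_ ?_
        · exact isClosed_biInter fun v _ => isClosed_eq (by fun_prop) (hc' v)
        · exact isClosed_biInter fun v _ => isClosed_le (by fun_prop) (hc' v)
      exact hclosed.isOpen_compl.mem_nhds hn
    filter_upwards [hcpt, hC] with s h1 h2 hT
    obtain ⟨ℓ, k1, -, k3⟩ := hT.le
    exact absurd ⟨k1, k3⟩ (h1 ℓ (by simpa using h2 ℓ k3))
  filter_upwards [(Filter.eventually_all_finite V.powerset.finite_toSet).2 key] with s hs S hS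
  exact hs S (by simpa using hS.1) hS

lemma eventually_tight_iff (hcont : ∀ v, Continuous fun t => ω t v) (hV : ∀ x, InCone V x)
    {t : ℝ} (hi : ∀ S, Tight V (ω t) S → Indep S) :
    ∀ᶠ s in nhds t, ∀ S, Tight V (ω s) S ↔ Tight V (ω t) S := by
  have key : ∀ S ∈ (V.powerset : Set (Finset E)), ∀ᶠ s in nhds t,
      Tight V (ω t) S → Tight V (ω s) S := by
    intro S _
    by_cases h : Tight V (ω t) S
    · filter_upwards [h.eventually hcont (hi S h)] with s hs _ using hs
    · exact Filter.Eventually.of_forall fun _ h' => absurd h' h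
  filter_upwards [(Filter.eventually_all_finite V.powerset.finite_toSet).2 key,
    eventually_tight_subset hcont hV t] with s hs hs' S
  refine ⟨fun h => ?_, fun h => hs S (by simpa using h.1) h⟩
  obtain ⟨S', hSS', hS'⟩ := hs' S h
  exact hS'.subset (hi _ hS') hSS'

end Families

/-! ### Bistellar moves between fans -/

section Flips

variable {E : Type*} [NormedAddCommGroup E] [InnerProductSpace ℝ E] [FiniteDimensional ℝ E]
  [DecidableEq E]

/-- The bistellar move replacing `A ⋆ ∂B` with `∂A ⋆ B`. -/
def FanMove (F F' : Set (Finset E)) : Prop :=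
  IsFan F ∧ IsFan F' ∧ ∃ A B : Finset E, A.Nonempty ∧ A ∈ F ∧ B ∉ F ∧ B.Nonempty ∧
    A.card + B.card = Module.finrank ℝ E + 1 ∧
    {C : Finset E | C.Nonempty ∧ Disjoint A C ∧ A ∪ C ∈ F} = {C | C.Nonempty ∧ C ⊂ B} ∧
    F' = (F \ {s | A ⊆ s}) ∪ {s | ∃ A' : Finset E, A' ⊂ A ∧ s = A' ∪ B}

lemma fanMove_of_sides {G : Set (Finset E)} {A B : Finset E} (hAB : Disjoint A B)
    (hA : A.Nonempty) (hB : B.Nonempty) (hcard : A.card + B.card = Module.finrank ℝ E + 1)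
    (hGA : ∀ S ∈ G, ¬ A ⊆ S) (hGB : ∀ S ∈ G, ¬ B ⊆ S)
    (h₁ : IsFan (G ∪ {S | S ⊂ A ∪ B ∧ ¬ B ⊆ S})) (h₂ : IsFan (G ∪ {S | S ⊂ A ∪ B ∧ ¬ A ⊆ S})) :
    FanMove (G ∪ {S | S ⊂ A ∪ B ∧ ¬ B ⊆ S}) (G ∪ {S | S ⊂ A ∪ B ∧ ¬ A ⊆ S}) := by
  have hnBA : ∀ C : Finset E, Disjoint B C → ¬ B ⊆ C := fun C hd hs => by
    obtain ⟨x, hx⟩ := hB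
    exact Finset.disjoint_left.1 hd hx (hs hx)
  have hss : ∀ C : Finset E, C ⊆ A ∪ B → ¬ B ⊆ C → C ⊂ A ∪ B := fun C h1 h2 =>
    h1.ssubset_of_ne fun h => h2 (h ▸ Finset.subset_union_right)
  have hss' : ∀ C : Finset E, C ⊆ A ∪ B → ¬ A ⊆ C → C ⊂ A ∪ B := fun C h1 h2 =>
    h1.ssubset_of_ne fun h => h2 (h ▸ Finset.subset_union_left)
  refine ⟨h₁, h₂, A, B, hA, Or.inr ⟨?_, hnBA A hAB.symm⟩, ?_, hB, hcard, ?_, ?_⟩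
  · exact hss A Finset.subset_union_left (hnBA A hAB.symm)
  · rintro (h | h)
    · exact hGB B h subset_rfl
    · exact h.2 subset_rfl
  · ext C
    simp only [Set.mem_ofPred_eq]
    constructor
    · rintro ⟨hC, hd, h | ⟨h, h'⟩⟩
      · exact absurd Finset.subset_union_left (hGA _ h)
      · refine ⟨hC, ?_⟩
        have h1 : C ⊆ B := fun x hx =>
          (Finset.mem_union.1 (h.subset (Finset.mem_union_right A hx))).resolve_left
            fun hxA => Finset.disjoint_left.1 hd hxA hx
        exact h1.ssubset_of_ne fun h2 => h' (h2 ▸ Finset.subset_union_right)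
    · rintro ⟨hC, h⟩
      have h' : ¬ B ⊆ A ∪ C := fun hs => h.not_subset fun x hx =>
        (Finset.mem_union.1 (hs hx)).resolve_left fun hxA => Finset.disjoint_left.1 hAB hxA hx
      exact ⟨hC, Finset.disjoint_of_subset_right h.subset hAB, Or.inr
        ⟨hss _ (Finset.union_subset_union_right h.subset) h', h'⟩⟩
  · ext S
    simp only [Set.mem_union, Set.mem_sdiff, Set.mem_ofPred_eq]
    constructor
    · rintro (h | ⟨h, h'⟩)
      · exact Or.inl ⟨Or.inl h, hGA S h⟩
      · by_cases hBS : B ⊆ S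
        · refine Or.inr ⟨S ∩ A, Finset.inter_subset_right.ssubset_of_ne fun h2 =>
            h' (h2 ▸ Finset.inter_subset_left), ?_⟩
          ext x
          simp only [Finset.mem_union, Finset.mem_inter]
          constructor
          · intro hx
            rcases Finset.mem_union.1 (h.subset hx) with h2 | h2
            · exact Or.inl ⟨hx, h2⟩
            · exact Or.inr h2
          · rintro (h2 | h2)
            · exact h2.1
            · exact hBS h2
        · exact Or.inl ⟨Or.inr ⟨h, hBS⟩, h'⟩
    · rintro (⟨h | h, h'⟩ | ⟨A', hA', rfl⟩)
      · exact Or.inl h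
      · exact Or.inr ⟨h.1, h'⟩
      · have h' : ¬ A ⊆ A' ∪ B := fun hs => hA'.not_subset fun x hx =>
          (Finset.mem_union.1 (hs hx)).resolve_right fun hxB => Finset.disjoint_left.1 hAB hx hxB
        exact Or.inr ⟨hss' _ (Finset.union_subset_union_left hA'.subset) h', h'⟩

/-- `α` is the coefficient vector of the linear relation on the minimally dependent set `Z`. -/
structure IsCircuit (Z : Finset E) (α : E → ℝ) : Prop where
  sum_eq : ∑ v ∈ Z, α v • v = 0
  ne_zero : ∀ v ∈ Z, α v ≠ 0
  indep : ∀ z ∈ Z, Indep (Z.erase z)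

lemma IsCircuit.neg {Z : Finset E} {α : E → ℝ} (h : IsCircuit Z α) : IsCircuit Z (-α) :=
  ⟨by simpa [neg_smul] using h.sum_eq, fun v hv => by simpa using h.ne_zero v hv, h.indep⟩

lemma IsCircuit.not_indep {Z S : Finset E} {α : E → ℝ} (h : IsCircuit Z α) (hne : Z.Nonempty)
    (hZS : Z ⊆ S) : ¬ Indep S := fun hi => by
  obtain ⟨z, hz⟩ := hne
  exact h.ne_zero z hz ((hi.subset hZS) α h.sum_eq z hz)

lemma Tight.sum_le {V Z S : Finset E} {ω α : E → ℝ} (hS : Tight V ω S) (hZ : Z ⊆ V)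
    (h0 : ∑ v ∈ Z, α v • v = 0) (hA : ∀ v ∈ Z, 0 < α v → v ∈ S) :
    ∑ v ∈ Z, α v * ω v ≤ 0 ∧
      ((∑ v ∈ Z, α v * ω v = 0) → (∀ v ∈ Z, α v ≠ 0) → Z ⊆ S) := by
  obtain ⟨ℓ, h1, h2, h3⟩ := hS.le
  have e0 : ∑ v ∈ Z, α v * ⟪ℓ, v⟫ = 0 := by rw [← inner_sum_smul, h0, inner_zero_right]
  have hle : ∀ v ∈ Z, α v * ω v ≤ α v * ⟪ℓ, v⟫ := by
    intro v hv
    rcases le_or_gt (α v) 0 with h | h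
    · exact mul_le_mul_of_nonpos_left (h3 v (hZ hv)) h
    · rw [h1 v (hA v hv h)]
  refine ⟨e0 ▸ Finset.sum_le_sum hle, fun h hne v hv => ?_⟩
  have := (Finset.sum_eq_sum_iff_of_le hle).1 (h.trans e0.symm) v hv
  by_contra hvS
  exact (h2 v (hZ hv) hvS).ne (mul_left_cancel₀ (hne v hv) this).symm

lemma Tight.sum_eq_zero {V Z : Finset E} {ω α : E → ℝ} (hZ : Tight V ω Z)
    (h0 : ∑ v ∈ Z, α v • v = 0) : ∑ v ∈ Z, α v * ω v = 0 := by
  obtain ⟨ℓ, h1, -, -⟩ := hZ.le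
  have : ∑ v ∈ Z, α v * ω v = ∑ v ∈ Z, α v * ⟪ℓ, v⟫ :=
    Finset.sum_congr rfl fun v hv => by rw [h1 v hv]
  rw [this, ← inner_sum_smul, h0, inner_zero_right]

variable {V : Finset E} {ω : ℝ → E → ℝ}

lemma IsCircuit.eventually_erase (hcont : ∀ v, Continuous fun t => ω t v) {Z : Finset E}
    {α : E → ℝ} (hα : IsCircuit Z α) {t : ℝ} (hZ : Tight V (ω t) Z) :
    ∀ᶠ s in nhds t, ∀ z ∈ Z, 0 < α z → 0 < ∑ v ∈ Z, α v * ω s v →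
      Tight V (ω s) (Z.erase z) := by
  refine (Filter.eventually_all_finite Z.finite_toSet).2 fun z hz => ?_
  have hz' : z ∈ Z := hz
  obtain ⟨hZV, ℓ, h1, h2⟩ := hZ
  obtain ⟨u, hu⟩ := (hα.indep z hz').exists_dual
  set L : ℝ → E := fun s => ℓ + ∑ v ∈ Z.erase z, (ω s v - ω t v) • u v with hL
  have hLc : Continuous L := by fun_prop
  have hLt : L t = ℓ := by simp [hL]
  have hev : ∀ᶠ s in nhds t, ∀ v ∈ (V : Set E), v ∉ Z → ⟪L s, v⟫ < ω s v := by
    refine (Filter.eventually_all_finite V.finite_toSet).2 fun v hv => ?_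
    by_cases hvS : v ∈ Z
    · exact Filter.Eventually.of_forall fun _ h => absurd hvS h
    have hc : Continuous fun s => ω s v - ⟪L s, v⟫ := by fun_prop
    filter_upwards [(hc.tendsto t).eventually_const_lt (u := 0)
      (by rw [hLt]; linarith [h2 v hv hvS])] with s hs _
    linarith
  filter_upwards [hev] with s hs hαz hτ
  have hval : ∀ v ∈ Z.erase z, ⟪L s, v⟫ = ω s v := fun v hv => by
    rw [hL, inner_add_left, inner_sum_dual hu (fun v => ω s v - ω t v) hv,
      h1 v (Finset.mem_of_mem_erase hv)]
    ring
  refine ⟨(Finset.erase_subset _ _).trans hZV, L s, hval, fun v hv hvz => ?_⟩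
  by_cases hvZ : v ∈ Z
  · have hvz' : v = z := by
      by_contra hne
      exact hvz (Finset.mem_erase.2 ⟨hne, hvZ⟩)
    subst hvz'
    have e0 : ∑ w ∈ Z, α w * ⟪L s, w⟫ = 0 := by rw [← inner_sum_smul, hα.sum_eq, inner_zero_right]
    rw [← Finset.add_sum_erase _ _ hvZ, Finset.sum_congr rfl fun w hw => by rw [hval w hw]] at e0
    rw [← Finset.add_sum_erase _ _ hvZ] at hτ
    have : 0 < α v * (ω s v - ⟪L s, v⟫) := by rw [mul_sub]; linarith
    linarith [pos_of_mul_pos_right this hαz.le]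
  · exact hs v hv hvZ

/-- The tight sets just after a value of the parameter at which exactly one circuit is tight. -/
lemma IsCircuit.eventually_tight_iff (hcont : ∀ v, Continuous fun t => ω t v)
    (hV : ∀ x, InCone V x) {Z : Finset E} {α : E → ℝ} (hα : IsCircuit Z α) {t : ℝ}
    (hZ : Tight V (ω t) Z) (hi : ∀ S, Tight V (ω t) S → S ≠ Z → Indep S) :
    ∀ᶠ s in nhds t, 0 < ∑ v ∈ Z, α v * ω s v → ∀ S, Tight V (ω s) S ↔
      (Tight V (ω t) S ∧ S ≠ Z) ∨ (S ⊂ Z ∧ ¬ Z.filter (fun v => 0 < α v) ⊆ S) := by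
  have key : ∀ S ∈ (V.powerset : Set (Finset E)), ∀ᶠ s in nhds t,
      Tight V (ω t) S → S ≠ Z → Tight V (ω s) S := by
    intro S _
    by_cases h : Tight V (ω t) S ∧ S ≠ Z
    · filter_upwards [h.1.eventually hcont (hi S h.1 h.2)] with s hs _ _ using hs
    · exact Filter.Eventually.of_forall fun _ h1 h2 => absurd ⟨h1, h2⟩ h
  filter_upwards [(Filter.eventually_all_finite V.powerset.finite_toSet).2 key,
    eventually_tight_subset hcont hV t, hα.eventually_erase hcont hZ] with s h1 h2 h3 hτ S
  constructor
  · intro hS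
    have hnA : ¬ Z.filter (fun v => 0 < α v) ⊆ S := fun hAS =>
      hτ.not_ge (hS.sum_le hZ.1 hα.sum_eq fun v hv hv' =>
        hAS (Finset.mem_filter.2 ⟨hv, hv'⟩)).1
    have hSZ : S ≠ Z := fun h => hnA (h ▸ Finset.filter_subset _ _)
    obtain ⟨S', hSS', hS'⟩ := h2 S hS
    by_cases hS'Z : S' = Z
    · exact Or.inr ⟨(hS'Z ▸ hSS').ssubset_of_ne hSZ, hnA⟩
    · exact Or.inl ⟨hS'.subset (hi _ hS' hS'Z) hSS', hSZ⟩
  · rintro (⟨hS, hSZ⟩ | ⟨hSZ, hnA⟩)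
    · exact h1 S (by simpa using hS.1) hS hSZ
    · obtain ⟨z, hz, hzS⟩ := Finset.not_subset.1 hnA
      obtain ⟨hz, hαz⟩ := Finset.mem_filter.1 hz
      exact (h3 z hz hαz hτ).subset (hα.indep z hz) fun x hx =>
        Finset.mem_erase.2 ⟨fun h => hzS (h ▸ hx), hSZ.subset hx⟩

/-- At the parameter `t` exactly one circuit is tight, and its height function changes sign. -/
def IsSwitch (V : Finset E) (ω : ℝ → E → ℝ) (t : ℝ) : Prop :=
  ∃ Z α, Tight V (ω t) Z ∧ Z.card = Module.finrank ℝ E + 1 ∧ IsCircuit Z α ∧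
    (∀ S, Tight V (ω t) S → S ≠ Z → Indep S) ∧
    (∀ s, t < s → 0 < ∑ v ∈ Z, α v * ω s v) ∧ ∀ s < t, ∑ v ∈ Z, α v * ω s v < 0

/-- Related by bistellar moves. -/
def Moves (F F' : Set (Finset E)) : Prop := Relation.ReflTransGen FanMove F F'

lemma moves_local (hcont : ∀ v, Continuous fun t => ω t v) (hV : ∀ x, InCone V x)
    (hunit : ∀ v ∈ V, ‖v‖ = 1) (hpos : ∀ t, ∀ v ∈ V, 0 < ω t v) {t : ℝ}
    (h : (∀ S, Tight V (ω t) S → Indep S) ∨ IsSwitch V ω t) :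
    ∃ U ∈ nhds t, ∀ x ∈ U, ∀ y ∈ U, x ≠ t → y ≠ t →
      Moves {S | Tight V (ω x) S} {S | Tight V (ω y) S} := by
  rcases h with h | ⟨Z, α, hZ, hcard, hα, hi, hgt, hlt⟩
  · refine ⟨_, SphFan.eventually_tight_iff hcont hV h, fun x hx y hy _ _ => ?_⟩
    have : {S | Tight V (ω x) S} = {S | Tight V (ω y) S} := by
      ext S; exact (hx S).trans (hy S).symm
    rw [this]
    exact Relation.ReflTransGen.refl
  · have hZne : Z.Nonempty := Finset.card_pos.1 (by omega)
    set A := Z.filter fun v => 0 < α v with hA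
    set B := Z.filter fun v => 0 < (-α) v with hB
    set G := {S | Tight V (ω t) S ∧ S ≠ Z} with hG
    have hABZ : A ∪ B = Z := by
      ext v
      simp only [hA, hB, Finset.mem_union, Finset.mem_filter, Pi.neg_apply, neg_pos]
      constructor
      · rintro (h | h) <;> exact h.1
      · intro h
        rcases (hα.ne_zero v h).lt_or_gt with h' | h'
        · exact Or.inr ⟨h, h'⟩
        · exact Or.inl ⟨h, h'⟩
    have hdisj : Disjoint A B := by
      rw [Finset.disjoint_left]
      intro v h1 h2
      have h1 := (Finset.mem_filter.1 h1).2
      have h2 := (Finset.mem_filter.1 h2).2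
      simp only [Pi.neg_apply, neg_pos] at h2
      exact h1.not_gt h2
    have hτ : ∑ v ∈ Z, α v * ω t v = 0 := hZ.sum_eq_zero hα.sum_eq
    have hτ' : ∀ s, ∑ v ∈ Z, (-α) v * ω s v = - ∑ v ∈ Z, α v * ω s v := fun s => by simp
    have hne : ∀ β : E → ℝ, ∑ v ∈ Z, β v * ω t v = 0 → IsCircuit Z β →
        (Z.filter fun v => 0 < β v).Nonempty := by
      intro β h0 hβ
      by_contra hcon
      rw [Finset.not_nonempty_iff_eq_empty, Finset.filter_eq_empty_iff] at hcon
      have : ∑ v ∈ Z, β v * ω t v < 0 := Finset.sum_neg (fun v hv =>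
        mul_neg_of_neg_of_pos (lt_of_le_of_ne (not_lt.1 (hcon hv)) (hβ.ne_zero v hv))
          (hpos t v (hZ.1 hv))) hZne
      exact this.ne h0
    have hAne : A.Nonempty := hne α hτ hα
    have hBne : B.Nonempty := hne (-α) (by rw [hτ', hτ, neg_zero]) hα.neg
    have hGn : ∀ β : E → ℝ, ∑ v ∈ Z, β v * ω t v = 0 → IsCircuit Z β →
        ∀ S ∈ G, ¬ (Z.filter fun v => 0 < β v) ⊆ S := by
      rintro β h0 hβ S ⟨hS, hSZ⟩ hAS
      have := (hS.sum_le hZ.1 hβ.sum_eq fun v hv hv' =>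
        hAS (Finset.mem_filter.2 ⟨hv, hv'⟩)).2 h0 hβ.ne_zero
      exact hβ.not_indep hZne this (hi S hS hSZ)
    have hGA : ∀ S ∈ G, ¬ A ⊆ S := hGn α hτ hα
    have hGB : ∀ S ∈ G, ¬ B ⊆ S := hGn (-α) (by rw [hτ', hτ, neg_zero]) hα.neg
    have hfan : ∀ (β : E → ℝ) s, IsCircuit Z β → (∀ S, Tight V (ω s) S ↔
        (Tight V (ω t) S ∧ S ≠ Z) ∨ (S ⊂ Z ∧ ¬ Z.filter (fun v => 0 < β v) ⊆ S)) →
        IsFan {S | Tight V (ω s) S} := by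
      intro β s hβ hs
      refine tight_isFan hunit (hpos s) fun S hS => ?_
      rcases (hs S).1 hS with h | h
      · exact hi S h.1 h.2
      · obtain ⟨z, hz, hzS⟩ := Finset.not_subset.1 h.2
        exact (hβ.indep z (Finset.mem_filter.1 hz).1).subset fun x hx =>
          Finset.mem_erase.2 ⟨fun h => hzS (h ▸ hx), h.1.subset hx⟩
    refine ⟨_, (hα.eventually_tight_iff hcont hV hZ hi).and
      (hα.neg.eventually_tight_iff hcont hV hZ hi), ?_⟩
    have hside : ∀ x, x ≠ t → ((0 < ∑ v ∈ Z, α v * ω x v → ∀ S, Tight V (ω x) S ↔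
        (Tight V (ω t) S ∧ S ≠ Z) ∨ (S ⊂ Z ∧ ¬ A ⊆ S)) ∧
        (0 < ∑ v ∈ Z, (-α) v * ω x v → ∀ S, Tight V (ω x) S ↔
        (Tight V (ω t) S ∧ S ≠ Z) ∨ (S ⊂ Z ∧ ¬ B ⊆ S))) →
        ({S | Tight V (ω x) S} = G ∪ {S | S ⊂ A ∪ B ∧ ¬ A ⊆ S} ∧ IsFan {S | Tight V (ω x) S}) ∨
        ({S | Tight V (ω x) S} = G ∪ {S | S ⊂ A ∪ B ∧ ¬ B ⊆ S} ∧
          IsFan {S | Tight V (ω x) S}) := by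
      rintro x hxt ⟨h1, h2⟩
      rw [hABZ]
      rcases hxt.lt_or_gt with h | h
      · have h3 := h2 (by rw [hτ']; linarith [hlt x h])
        exact Or.inr ⟨Set.ext h3, hfan (-α) x hα.neg h3⟩
      · have h3 := h1 (hgt x h)
        exact Or.inl ⟨Set.ext h3, hfan α x hα h3⟩
    have hc : A.card + B.card = Module.finrank ℝ E + 1 := by
      rw [← hcard, ← hABZ, Finset.card_union_of_disjoint hdisj]
    intro x hx y hy hxt hyt
    rcases hside x hxt hx with ⟨h1, h1'⟩ | ⟨h1, h1'⟩ <;>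
      rcases hside y hyt hy with ⟨h2, h2'⟩ | ⟨h2, h2'⟩
    · rw [h1, h2]; exact Relation.ReflTransGen.refl
    · rw [h1] at h1' ⊢
      rw [h2] at h2' ⊢
      rw [Finset.union_comm A B] at h1' h2' ⊢
      exact Relation.ReflTransGen.single (fanMove_of_sides hdisj.symm hBne hAne
        (by rw [add_comm]; exact hc) hGB hGA h1' h2')
    · rw [h1] at h1' ⊢
      rw [h2] at h2' ⊢
      exact Relation.ReflTransGen.single (fanMove_of_sides hdisj hAne hBne hc hGA hGB h1' h2')
    · rw [h1, h2]; exact Relation.ReflTransGen.refl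

/-- Following a generic family of height functions gives a sequence of bistellar moves. -/
lemma moves_of_family (hcont : ∀ v, Continuous fun t => ω t v) (hV : ∀ x, InCone V x)
    (hunit : ∀ v ∈ V, ‖v‖ = 1) (hpos : ∀ t, ∀ v ∈ V, 0 < ω t v)
    (h : ∀ t, (∀ S, Tight V (ω t) S → Indep S) ∨ IsSwitch V ω t) {F F' : Set (Finset E)}
    (hF : ∀ᶠ t in Filter.atBot, {S | Tight V (ω t) S} = F)
    (hF' : ∀ᶠ t in Filter.atTop, {S | Tight V (ω t) S} = F') : Moves F F' := by
  have hloc := fun t => moves_local hcont hV hunit hpos (h t)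
  let R : Set ℝ := {t | ∀ᶠ y in nhdsWithin t {t}ᶜ, Moves F {S | Tight V (ω y) S}}
  have hRx : ∀ t : ℝ, ∀ U ∈ nhds t, (∀ x ∈ U, ∀ y ∈ U, x ≠ t → y ≠ t →
      Moves {S | Tight V (ω x) S} {S | Tight V (ω y) S}) → ∀ x ∈ U, x ≠ t →
      Moves F {S | Tight V (ω x) S} → ∀ y ∈ U, y ≠ t → Moves F {S | Tight V (ω y) S} :=
    fun t U _ hU x hx hxt hFx y hy hyt => hFx.trans (hU x hx y hy hxt hyt)
  have hRd : ∀ t, t ∈ R → ∀ᶠ y in nhdsWithin t {t}ᶜ, Moves F {S | Tight V (ω y) S} :=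
    fun t ht => ht
  have hmem : ∀ t : ℝ, ∀ U ∈ nhds t, (∀ᶠ y in nhdsWithin t {t}ᶜ, y ∈ U ∧ y ≠ t) := by
    intro t U hU
    have h1 : ∀ᶠ y in nhdsWithin t {t}ᶜ, y ∈ U := nhdsWithin_le_nhds hU
    have h2 : ∀ᶠ y in nhdsWithin t {t}ᶜ, y ≠ t := self_mem_nhdsWithin
    exact h1.and h2
  have hopen : IsOpen R := by
    rw [isOpen_iff_mem_nhds]
    intro t ht
    obtain ⟨U, hU, hUm⟩ := hloc t
    obtain ⟨x, hFx, hxU, hxt⟩ := ((hRd t ht).and (hmem t U hU)).exists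
    have hall := hRx t U hU hUm x hxU hxt hFx
    filter_upwards [eventually_mem_nhds_iff.2 hU] with y hy
    by_cases hyt : y = t
    · rw [hyt]; exact ht
    · filter_upwards [nhdsWithin_le_nhds hy, nhdsWithin_le_nhds (isOpen_ne.mem_nhds hyt)]
        with z hz hzt using hall z hz hzt
  have hclosed : IsClosed R := by
    rw [← isOpen_compl_iff, isOpen_iff_mem_nhds]
    intro t ht
    obtain ⟨U, hU, hUm⟩ := hloc t
    filter_upwards [eventually_mem_nhds_iff.2 hU] with y hy hyR
    obtain ⟨x, ⟨hFx, hxU, hxt⟩⟩ : ∃ x, Moves F {S | Tight V (ω x) S} ∧ x ∈ U ∧ x ≠ t := by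
      by_cases hyt : y = t
      · subst hyt; exact absurd hyR ht
      · obtain ⟨x, hx1, hx2, hx3⟩ := ((hRd y hyR).and
          (Filter.Eventually.and (nhdsWithin_le_nhds hy)
            (nhdsWithin_le_nhds (isOpen_ne.mem_nhds hyt)))).exists
        exact ⟨x, hx1, hx2, hx3⟩
    refine ht ?_
    filter_upwards [hmem t U hU] with z hz
    exact hRx t U hU hUm x hxU hxt hFx z hz.1 hz.2
  have hR : R = univ := by
    refine IsClopen.eq_univ ⟨hclosed, hopen⟩ ?_
    obtain ⟨a, ha⟩ := Filter.eventually_atBot.1 hF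
    refine ⟨a - 1, nhdsWithin_le_nhds ?_⟩
    filter_upwards [Iio_mem_nhds (show a - 1 < a by linarith)] with y hy
    rw [ha y (le_of_lt hy)]
    exact Relation.ReflTransGen.refl
  obtain ⟨b, hb⟩ := Filter.eventually_atTop.1 hF'
  have hbR : b + 1 ∈ R := hR ▸ mem_univ _
  obtain ⟨y, hy, hby⟩ := ((hRd _ hbR).and
    (nhdsWithin_le_nhds (Ioi_mem_nhds (show b < b + 1 by linarith)))).exists
  rwa [hb y (le_of_lt hby)] at hy

end Flips

/-! ### General position -/

section General

/-- A nonempty open set is not covered by finitely many affine hyperplanes. -/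
lemma exists_mem_forall_ne {X ι : Type*} [AddCommGroup X] [Module ℝ X] [TopologicalSpace X]
    [IsTopologicalAddGroup X] [ContinuousSMul ℝ X] {I : Set ι} (hI : I.Finite)
    (L : ι → X → ℝ) (hc : ∀ i, Continuous (L i)) (hadd : ∀ i x y, L i (x + y) = L i x + L i y)
    (hsmul : ∀ i (c : ℝ) x, L i (c • x) = c * L i x) (hL : ∀ i ∈ I, ∃ x, L i x ≠ 0)
    {U : Set X} (hU : IsOpen U) (hne : U.Nonempty) : ∃ x ∈ U, ∀ i ∈ I, L i x ≠ 0 := by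
  induction I, hI using Set.Finite.induction_on generalizing U with
  | empty => exact hne.imp fun x hx => ⟨hx, by simp⟩
  | @insert i I _ _ ih =>
    have hne' : (U ∩ {x | L i x ≠ 0}).Nonempty := by
      obtain ⟨x, hx⟩ := hne
      by_cases h : L i x = 0
      · obtain ⟨y, hy⟩ := hL i (mem_insert _ _)
        have hcont : Continuous fun η : ℝ => x + η • y := by fun_prop
        have hev : ∀ᶠ η : ℝ in nhdsWithin 0 {0}ᶜ, x + η • y ∈ U :=
          nhdsWithin_le_nhds (hcont.continuousAt.eventually_mem (hU.mem_nhds (by simpa using hx)))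
        have hev' : ∀ᶠ η : ℝ in nhdsWithin 0 {0}ᶜ, η ≠ 0 := self_mem_nhdsWithin
        obtain ⟨η, h1, h2⟩ := (hev.and hev').exists
        refine ⟨x + η • y, h1, ?_⟩
        rw [Set.mem_ofPred_eq, hadd, hsmul, h, zero_add]
        exact mul_ne_zero h2 hy
      · exact ⟨x, hx, h⟩
    obtain ⟨x, ⟨hxU, hx⟩, hxI⟩ := ih (fun j hj => hL j (mem_insert_of_mem _ hj))
      (hU.inter (isOpen_ne_fun (hc i) continuous_const)) hne'
    refine ⟨x, hxU, ?_⟩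
    rintro j (rfl | hj)
    · exact hx
    · exact hxI j hj

variable {E : Type*} [NormedAddCommGroup E] [InnerProductSpace ℝ E] [FiniteDimensional ℝ E]
  [DecidableEq E]

lemma Indep.insert {s : Finset E} (h : Indep s) {w : E}
    (hw : w ∉ Submodule.span ℝ (s : Set E)) : Indep (insert w s) := by
  rw [indep_iff] at h ⊢
  rw [Finset.coe_insert]
  exact h.id_insert hw

/-- A nonempty open cone contains a unit vector avoiding the spans of finitely many small sets. -/
lemma exists_unit_notMem_span {I : Set (Finset E)} (hI : I.Finite)
    (hcard : ∀ s ∈ I, s.card < Module.finrank ℝ E) {U : Set E} (hU : IsOpen U)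
    (hne : U.Nonempty) (hcone : ∀ x ∈ U, ∀ c : ℝ, 0 < c → c • x ∈ U)
    (h0 : (0 : E) ∉ U) :
    ∃ w ∈ U, ‖w‖ = 1 ∧ ∀ s ∈ I, w ∉ Submodule.span ℝ (s : Set E) := by
  have hex : ∀ s : Finset E, ∃ ℓ : E, s ∈ I → ℓ ≠ 0 ∧ ∀ v ∈ Submodule.span ℝ (s : Set E),
      ⟪ℓ, v⟫ = 0 := by
    intro s
    by_cases hs : s ∈ I
    · have hlt : Submodule.span ℝ (s : Set E) ≠ ⊤ := fun h => by
        have := finrank_span_finset_le_card (R := ℝ) s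
        rw [Set.finrank, h, finrank_top] at this
        exact absurd this (not_le.2 (hcard s hs))
      have hbot : (Submodule.span ℝ (s : Set E))ᗮ ≠ ⊥ := fun h =>
        hlt (Submodule.orthogonal_eq_bot_iff.1 h)
      obtain ⟨ℓ, h1, h2⟩ := Submodule.exists_mem_ne_zero_of_ne_bot hbot
      exact ⟨ℓ, fun _ => ⟨h2, fun v hv => Submodule.inner_left_of_mem_orthogonal hv h1⟩⟩
    · exact ⟨0, fun h => absurd h hs⟩
  choose ℓ hℓ using hex
  obtain ⟨w, hwU, hw⟩ := exists_mem_forall_ne hI (fun s x => ⟪ℓ s, x⟫) (fun s => by fun_prop)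
    (fun s x y => inner_add_right _ _ _) (fun s c x => real_inner_smul_right _ _ _)
    (fun s hs => ⟨ℓ s, fun h => (hℓ s hs).1 (inner_self_eq_zero.1 h)⟩) hU hne
  have hw0 : w ≠ 0 := fun h => h0 (h ▸ hwU)
  refine ⟨‖w‖⁻¹ • w, hcone w hwU _ (by positivity), by
    rw [norm_smul, norm_inv, norm_norm, inv_mul_cancel₀ (norm_ne_zero_iff.2 hw0)], fun s hs h => ?_⟩
  have := (hℓ s hs).2 _ h
  rw [real_inner_smul_right] at this
  exact (mul_ne_zero (by positivity) (hw s hs)) this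

/-- The union of a member of `P` and a subset of `G` is independent if it is small. -/
def GenericTo (P : Set (Finset E)) (G : Finset E) : Prop :=
  ∀ W₁ ∈ P, ∀ W₂ ⊆ G, W₁.card + W₂.card ≤ Module.finrank ℝ E → Indep (W₁ ∪ W₂)

lemma GenericTo.exists_insert {P : Set (Finset E)} (hP : P.Finite) {G N : Finset E}
    (hG : GenericTo P G) (hd : 2 ≤ Module.finrank ℝ E) {U : Set E} (hU : IsOpen U)
    (hne : U.Nonempty) (hcone : ∀ x ∈ U, ∀ c : ℝ, 0 < c → c • x ∈ U) (h0 : (0 : E) ∉ U) :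
    ∃ w ∈ U, ‖w‖ = 1 ∧ w ∉ N ∧ GenericTo P (insert w G) := by
  let I : Set (Finset E) := {s | s.card < Module.finrank ℝ E} ∩
    ((fun p : Finset E × Finset E => p.1 ∪ p.2) '' (P ×ˢ (G.powerset : Set (Finset E))) ∪
      (fun v => {v}) '' (N : Set E))
  have hI : I.Finite := (((hP.prod (Finset.finite_toSet _)).image _).union
    ((Finset.finite_toSet _).image _)).inter_of_right _
  obtain ⟨w, hwU, hw1, hw⟩ := exists_unit_notMem_span hI (fun s hs => hs.1) hU hne hcone h0
  refine ⟨w, hwU, hw1, fun hwN => ?_, fun W₁ h1 W₂ h2 hc => ?_⟩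
  · refine hw {w} ⟨?_, Or.inr ⟨w, hwN, rfl⟩⟩ (Submodule.subset_span (by simp))
    rw [Set.mem_ofPred_eq, Finset.card_singleton]
    omega
  · by_cases hwW : w ∈ W₂
    · have hcc := Finset.card_erase_add_one hwW
      have hsub : W₂.erase w ⊆ G := fun x hx =>
        (Finset.mem_insert.1 (h2 (Finset.mem_of_mem_erase hx))).resolve_left
          (Finset.ne_of_mem_erase hx)
      have hi := hG W₁ h1 _ hsub (by omega)
      have hun := Finset.card_union_le W₁ (W₂.erase w)
      have := hi.insert (hw _ ⟨by rw [Set.mem_ofPred_eq]; omega,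
        Or.inl ⟨(W₁, W₂.erase w), ⟨h1, Finset.mem_coe.2 (Finset.mem_powerset.2 hsub)⟩, rfl⟩⟩)
      rwa [← Finset.union_insert, Finset.insert_erase hwW] at this
    · exact hG W₁ h1 W₂ (fun x hx => (Finset.mem_insert.1 (h2 hx)).resolve_left
        fun h => hwW (h ▸ hx)) hc

/-- A generic set of `d + 1` unit vectors positively spanning a `d`-dimensional space. -/
lemma exists_generic {P : Set (Finset E)} (hP : P.Finite) (hP0 : ∅ ∈ P)
    (hPi : ∀ s ∈ P, Indep s) (hd : 2 ≤ Module.finrank ℝ E) (N : Finset E) :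
    ∃ G : Finset E, G.card = Module.finrank ℝ E + 1 ∧ (∀ v ∈ G, ‖v‖ = 1) ∧ Disjoint N G ∧
      GenericTo P G ∧ ∀ x, InCone G x := by
  have key : ∀ k, k ≤ Module.finrank ℝ E → ∃ G : Finset E, G.card = k ∧ (∀ v ∈ G, ‖v‖ = 1) ∧
      Disjoint N G ∧ GenericTo P G := by
    intro k
    induction k with
    | zero =>
      refine fun _ => ⟨∅, rfl, by simp, by simp, fun W₁ h1 W₂ h2 _ => ?_⟩
      rw [Finset.subset_empty.1 h2, Finset.union_empty]
      exact hPi _ h1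
    | succ k ih =>
      intro hk
      obtain ⟨G, h1, h2, h3, h4⟩ := ih (by omega)
      have : Nontrivial E := Module.nontrivial_of_finrank_pos (R := ℝ) (by omega)
      obtain ⟨x, hx⟩ := exists_ne (0 : E)
      obtain ⟨w, -, k1, k2, k3⟩ := h4.exists_insert (N := N ∪ G) hP hd
        (isOpen_compl_singleton (x := (0 : E))) ⟨x, hx⟩
        (fun x hx c hc => smul_ne_zero hc.ne' hx) (by simp)
      rw [Finset.notMem_union] at k2
      refine ⟨insert w G, by rw [Finset.card_insert_of_notMem k2.2, h1], ?_, ?_, k3⟩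
      · simpa [k1] using h2
      · rw [Finset.disjoint_insert_right]; exact ⟨k2.1, h3⟩
  obtain ⟨G, h1, h2, h3, h4⟩ := key _ le_rfl
  have hGi : Indep G := by simpa using h4 ∅ hP0 G subset_rfl (by simp [h1])
  obtain ⟨u, hu⟩ := hGi.exists_dual
  have hGne : G.Nonempty := Finset.card_pos.1 (by omega)
  obtain ⟨w, hwU, k1, k2, k3⟩ := h4.exists_insert (N := N ∪ G) (U := ⋂ v ∈ G, {x | ⟪u v, x⟫ < 0})
    hP hd (isOpen_biInter_finset fun v _ => isOpen_lt (by fun_prop) continuous_const)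
    ⟨∑ v ∈ G, (-1 : ℝ) • v, by
      simp only [Set.mem_iInter]
      intro v hv
      rw [Set.mem_ofPred_eq, inner_dual_sum hu (fun _ => -1) hv]; norm_num⟩
    (fun x hx c hc => by
      simp only [Set.mem_iInter] at hx ⊢
      intro v hv
      rw [Set.mem_ofPred_eq, real_inner_smul_right]
      exact mul_neg_of_pos_of_neg hc (hx v hv))
    (fun h => by
      obtain ⟨v, hv⟩ := hGne
      simp only [Set.mem_iInter] at h
      simpa using h v hv)
  rw [Finset.notMem_union] at k2
  simp only [Set.mem_iInter] at hwU
  refine ⟨insert w G, by rw [Finset.card_insert_of_notMem k2.2, h1], by simpa [k1] using h2,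
    by rw [Finset.disjoint_insert_right]; exact ⟨k2.1, h3⟩, k3, ?_⟩
  have hneg : ∀ v ∈ G, InCone (insert w G) (-v) := by
    intro v hv
    obtain ⟨a, ha⟩ := hGi.exists_sum_eq h1 w
    have hav : ∀ v ∈ G, a v < 0 := fun v hv => by
      have := hwU v hv
      rwa [Set.mem_ofPred_eq, ← ha, inner_dual_sum hu a hv] at this
    have hw' : InCone (insert w G) (w + ∑ x ∈ G.erase v, (-a x) • x) :=
      (inCone_self (Finset.mem_insert_self _ _)).add
        (inCone_sum _ _ _ (fun x hx => (neg_pos.2 (hav x (Finset.mem_of_mem_erase hx))).le)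
          fun x hx => inCone_self (Finset.mem_insert_of_mem (Finset.mem_of_mem_erase hx)))
    have he : (-a v)⁻¹ • (w + ∑ x ∈ G.erase v, (-a x) • x) = -v := by
      have h5 : w + ∑ x ∈ G.erase v, (-a x) • x = a v • v := by
        rw [← ha, ← Finset.add_sum_erase _ _ hv]
        simp
      rw [h5, smul_smul, inv_neg, neg_mul, inv_mul_cancel₀ (hav v hv).ne, neg_one_smul]
    rw [← he]
    exact hw'.smul (inv_nonneg.2 (neg_pos.2 (hav v hv)).le)
  intro x
  obtain ⟨a, rfl⟩ := hGi.exists_sum_eq h1 x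
  have : ∀ v ∈ G, InCone (insert w G) (a v • v) := by
    intro v hv
    rcases le_total 0 (a v) with h | h
    · exact (inCone_self (Finset.mem_insert_of_mem hv)).smul h
    · have := (hneg v hv).smul (neg_nonneg.2 h)
      simpa using this
  have h6 := inCone_sum G (s := insert w G) (fun v => a v • v) (fun _ => 1) (by simp) this
  simpa using h6

end General

/-! ### Connecting two fans through a generic one -/

section Connect

variable {E : Type*} [NormedAddCommGroup E] [InnerProductSpace ℝ E] [FiniteDimensional ℝ E]
  [DecidableEq E]

lemma exists_isCircuit {Z : Finset E} (hi : ∀ z ∈ Z, Indep (Z.erase z)) (hn : ¬ Indep Z) :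
    ∃ α, IsCircuit Z α ∧ ∀ v, v ∉ Z → α v = 0 := by
  unfold Indep at hn
  push Not at hn
  obtain ⟨a, ha, z, hz, haz⟩ := hn
  set α : E → ℝ := fun v => if v ∈ Z then a v else 0 with hα
  have hαa : ∀ v ∈ Z, α v = a v := fun v hv => by simp [hα, hv]
  have hsum : ∑ v ∈ Z, α v • v = 0 := by
    rw [← ha]; exact Finset.sum_congr rfl fun v hv => by rw [hαa v hv]
  refine ⟨α, ⟨hsum, fun v hv h0 => ?_, hi⟩, fun v hv => by simp [hα, hv]⟩
  rw [← Finset.add_sum_erase _ _ hv, h0, zero_smul, zero_add] at hsum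
  have hzv : z ≠ v := fun h => haz (by rw [h, ← hαa v hv, h0])
  exact haz (by rw [← hαa z hz]; exact hi v hv α hsum z (Finset.mem_erase.2 ⟨hzv, hz⟩))

lemma exists_mem_forall_sum_ne (V : Finset E) {C : Set (E → ℝ)} (hC : C.Finite)
    (h : ∀ c ∈ C, ∃ v ∈ V, c v ≠ 0) {U : Set (E → ℝ)} (hU : IsOpen U) (hne : U.Nonempty) :
    ∃ f ∈ U, ∀ c ∈ C, ∑ v ∈ V, c v * f v ≠ 0 := by
  refine exists_mem_forall_ne hC (fun c (f : E → ℝ) => ∑ v ∈ V, c v * f v) (fun c => by fun_prop)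
    (fun c f g => by simp [mul_add, Finset.sum_add_distrib])
    (fun c r f => by simp only [Pi.smul_apply, smul_eq_mul, Finset.mul_sum, mul_left_comm])
    (fun c hc => ?_) hU hne
  obtain ⟨v, hv, hcv⟩ := h c hc
  refine ⟨Pi.single v 1, ?_⟩
  rw [Finset.sum_eq_single v (fun w _ hw => by simp [hw]) (fun h => absurd hv h)]
  simpa using hcv

lemma tight_iff_mem {B : Set (Finset E)} (hB : IsFan B) (hc : Complete B) {V : Finset E}
    {ω : E → ℝ} (h : ∀ s ∈ B, Tight V ω s) {S : Finset E} : Tight V ω S ↔ S ∈ B := by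
  refine ⟨fun hS => ?_, h S⟩
  obtain ⟨s, hs, hx⟩ := hc (∑ v ∈ S, (1 : ℝ) • v)
  exact hB.down s hs S (hS.subset_of_inCone (h s hs) ⟨fun _ => 1, by simp, rfl⟩ hx.inCone)

/-- The sets of `d + 1` vectors which may become tight in a family joining `B` to `G`. -/
def potentials (B : Set (Finset E)) (G : Finset E) : Set (Finset E) :=
  {Z | Z.card = Module.finrank ℝ E + 1 ∧ ∃ W₁ ∈ B, ∃ W₂ ⊆ G, Z = W₁ ∪ W₂}

lemma finite_potentials {B : Set (Finset E)} (hB : B.Finite) (G : Finset E) :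
    (potentials B G).Finite := by
  refine ((hB.prod G.powerset.finite_toSet).image fun p : Finset E × Finset E => p.1 ∪ p.2).subset
    ?_
  rintro Z ⟨-, W₁, h1, W₂, h2, rfl⟩
  exact ⟨(W₁, W₂), ⟨h1, Finset.mem_coe.2 (Finset.mem_powerset.2 h2)⟩, rfl⟩

lemma exists_isCircuit_of_potentials {B : Set (Finset E)} (hB : IsFan B) {G Z : Finset E}
    (hG : GenericTo B G) (hBG : ∀ s ∈ B, Disjoint s G) (hZ : Z ∈ potentials B G) :
    ∃ α, IsCircuit Z α ∧ ∀ v, v ∉ Z → α v = 0 := by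
  obtain ⟨hcard, W₁, h1, W₂, h2, rfl⟩ := hZ
  have hd : Disjoint W₁ W₂ := Finset.disjoint_of_subset_right h2 (hBG _ h1)
  refine exists_isCircuit (fun z hz => ?_) fun h => by have := h.card_le; omega
  have he : (W₁ ∪ W₂).erase z = W₁.erase z ∪ W₂.erase z := Finset.erase_union_distrib _ _ _
  have hc := Finset.card_erase_of_mem hz
  rw [he]
  refine hG _ (hB.down _ h1 _ (Finset.erase_subset _ _)) _
    ((Finset.erase_subset _ _).trans h2) ?_
  rw [← Finset.card_union_of_disjoint (Finset.disjoint_of_subset_left (Finset.erase_subset _ _)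
    (Finset.disjoint_of_subset_right (Finset.erase_subset _ _) hd)), ← he]
  omega

lemma inter_nonempty_of_potentials {B : Set (Finset E)} (hB : IsFan B) {G Z : Finset E}
    (hZ : Z ∈ potentials B G) : (Z ∩ G).Nonempty := by
  obtain ⟨hcard, W₁, h1, W₂, h2, rfl⟩ := hZ
  by_contra hcon
  rw [Finset.not_nonempty_iff_eq_empty] at hcon
  have : W₂ = ∅ := Finset.subset_empty.1 (hcon ▸ Finset.subset_inter Finset.subset_union_right h2)
  rw [this, Finset.union_empty] at hcard
  have := (hB.indep h1).card_le
  omega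

lemma exists_generic_height {𝒵 : Set (Finset E)} (h𝒵 : 𝒵.Finite) {G : Finset E}
    (α : Finset E → E → ℝ) (hα : ∀ Z ∈ 𝒵, ∀ v, α Z v ≠ 0 ↔ v ∈ Z)
    (hne : ∀ Z ∈ 𝒵, (Z ∩ G).Nonempty) (N : Finset E) :
    ∃ g : E → ℝ, (∀ v ∈ G, 0 < g v) ∧ (∀ Z ∈ 𝒵, ∑ v ∈ G, α Z v * g v ≠ 0) ∧
      ∀ Z ∈ 𝒵, ∀ Z' ∈ 𝒵, ∀ v ∈ N, v ∈ Z → v ∈ Z' → Z ∩ G ≠ Z' ∩ G →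
        α Z' v * ∑ w ∈ G, α Z w * g w ≠ α Z v * ∑ w ∈ G, α Z' w * g w := by
  let I : Set ((Finset E × Finset E) × E) := {p | p.2 ∈ p.1.1 ∧ p.2 ∈ p.1.2 ∧
    p.1.1 ∩ G ≠ p.1.2 ∩ G} ∩ ((𝒵 ×ˢ 𝒵) ×ˢ (N : Set E))
  let c : (Finset E × Finset E) × E → E → ℝ := fun p w =>
    α p.1.2 p.2 * α p.1.1 w - α p.1.1 p.2 * α p.1.2 w
  have hI : I.Finite := ((h𝒵.prod h𝒵).prod N.finite_toSet).inter_of_right _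
  have hz : ∀ Z ∈ 𝒵, ∀ v, v ∉ Z → α Z v = 0 := fun Z hZ v hv => by
    by_contra h
    exact hv ((hα Z hZ v).1 h)
  have hC : ∀ d ∈ α '' 𝒵 ∪ c '' I, ∃ v ∈ G, d v ≠ 0 := by
    rintro d (⟨Z, hZ, rfl⟩ | ⟨⟨⟨Z, Z'⟩, v⟩, ⟨⟨h1, h2, h3⟩, ⟨h4, h5⟩, h6⟩, rfl⟩)
    · obtain ⟨v, hv⟩ := hne Z hZ
      rw [Finset.mem_inter] at hv
      exact ⟨v, hv.2, (hα Z hZ v).2 hv.1⟩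
    · dsimp only at h1 h2 h3 h4 h5 h6
      have : ∃ w ∈ G, ¬ (w ∈ Z ↔ w ∈ Z') := by
        by_contra hcon
        push Not at hcon
        refine h3 (Finset.ext fun w => ?_)
        simp only [Finset.mem_inter]
        exact ⟨fun h => ⟨(hcon w h.2).1 h.1, h.2⟩, fun h => ⟨(hcon w h.2).2 h.1, h.2⟩⟩
      obtain ⟨w, hw, hne⟩ := this
      refine ⟨w, hw, ?_⟩
      change α Z' v * α Z w - α Z v * α Z' w ≠ 0
      by_cases hwZ : w ∈ Z
      · have hwZ' : w ∉ Z' := fun h => hne ⟨fun _ => h, fun _ => hwZ⟩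
        rw [hz Z' h5 w hwZ', mul_zero, sub_zero]
        exact mul_ne_zero ((hα Z' h5 v).2 h2) ((hα Z h4 w).2 hwZ)
      · have hwZ' : w ∈ Z' := by
          by_contra h
          exact hne ⟨fun h' => absurd h' hwZ, fun h' => absurd h' h⟩
        rw [hz Z h4 w hwZ, mul_zero, zero_sub, neg_ne_zero]
        exact mul_ne_zero ((hα Z h4 v).2 h1) ((hα Z' h5 w).2 hwZ')
  obtain ⟨g, hg, h⟩ := exists_mem_forall_sum_ne G ((h𝒵.image α).union (hI.image c)) hC
    (U := ⋂ v ∈ G, {g | 0 < g v})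
    (isOpen_biInter_finset fun v _ => isOpen_lt continuous_const (continuous_apply v))
    ⟨fun _ => 1, by simp⟩
  simp only [Set.mem_iInter] at hg
  refine ⟨g, hg, fun Z hZ => h _ (Or.inl ⟨Z, hZ, rfl⟩), fun Z hZ Z' hZ' v hv h1 h2 h3 => ?_⟩
  have := h _ (Or.inr ⟨((Z, Z'), v), ⟨⟨h1, h2, h3⟩, ⟨hZ, hZ'⟩, hv⟩, rfl⟩)
  rw [← sub_ne_zero, Finset.mul_sum, Finset.mul_sum, ← Finset.sum_sub_distrib]
  convert this using 2
  ring_nf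
  simp only [c]
  ring

/-- The heights supporting a complete fan may be perturbed. -/
lemma Supported.eventually {B : Set (Finset E)} (hB : IsFan B) (hc : Complete B) {f₀ : E → ℝ}
    (hf : Supported B f₀) {V : Finset E} (hV : ∀ v, v ∈ V ↔ {v} ∈ B) :
    ∀ᶠ f in nhds f₀, (∀ v ∈ V, 0 < f v) ∧ ∀ S ∈ B, Tight V f S := by
  refine Filter.Eventually.and ((Filter.eventually_all_finite V.finite_toSet).2 fun v hv =>
    (continuous_apply v).continuousAt.eventually_const_lt (hf.1 v ((hV v).1 hv))) ?_
  refine (Filter.eventually_all_finite hB.finite).2 fun S hS => ?_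
  obtain ⟨T, hT, hST, hcard⟩ := hB.exists_facet hc hS
  obtain ⟨ℓ, h1, h2⟩ := hf.2 T hT hcard
  have hTt : Tight V f₀ T := ⟨fun v hv => (hV v).2 (hB.singleton_mem hT hv), ℓ, h1,
    fun v hv => h2 v ((hV v).1 hv)⟩
  exact Tight.eventually (ω := fun f : E → ℝ => f) (fun v => continuous_apply v)
    (hTt.subset (hB.indep hT) hST) (hB.indep hS)

end Connect

section Connect

variable {E : Type*} [NormedAddCommGroup E] [InnerProductSpace ℝ E] [FiniteDimensional ℝ E]
  [DecidableEq E]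

lemma IsSwitch.comp_neg {V : Finset E} {ω : ℝ → E → ℝ} {t : ℝ} (h : IsSwitch V ω (-t)) :
    IsSwitch V (fun s => ω (-s)) t := by
  obtain ⟨Z, α, h1, h2, h3, h4, h5, h6⟩ := h
  refine ⟨Z, -α, h1, h2, h3.neg, h4, fun s hs => ?_, fun s hs => ?_⟩
  · simpa using h6 (-s) (by linarith)
  · simpa using h5 (-s) (by linarith)

lemma moves_of_family_symm {V : Finset E} {ω : ℝ → E → ℝ}
    (hcont : ∀ v, Continuous fun t => ω t v) (hV : ∀ x, InCone V x)
    (hunit : ∀ v ∈ V, ‖v‖ = 1) (hpos : ∀ t, ∀ v ∈ V, 0 < ω t v)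
    (h : ∀ t, (∀ S, Tight V (ω t) S → Indep S) ∨ IsSwitch V ω t) {F F' : Set (Finset E)}
    (hF : ∀ᶠ t in Filter.atBot, {S | Tight V (ω t) S} = F)
    (hF' : ∀ᶠ t in Filter.atTop, {S | Tight V (ω t) S} = F') : Moves F F' ∧ Moves F' F :=
  ⟨moves_of_family hcont hV hunit hpos h hF hF',
    moves_of_family (ω := fun s => ω (-s)) (fun v => (hcont v).comp continuous_neg) hV hunit
      (fun t => hpos (-t)) (fun t => (h (-t)).imp id IsSwitch.comp_neg)
      (Filter.tendsto_neg_atBot_atTop.eventually hF')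
      (Filter.tendsto_neg_atTop_atBot.eventually hF)⟩

/-- The family of heights interpolating between `f` off `G` and `g` on `G`. -/
noncomputable def heights (G : Finset E) (f g : E → ℝ) (t : ℝ) (v : E) : ℝ :=
  if v ∈ G then g v else Real.exp t * f v

lemma heights_eventually_atBot {B : Set (Finset E)} (hB : IsFan B) (hc : Complete B)
    {V G : Finset E} (hVG : Disjoint V G) {f g : E → ℝ} (hg : ∀ v ∈ G, 0 < g v)
    (hf : ∀ S ∈ B, Tight V f S) :
    ∀ᶠ t in Filter.atBot, {S | Tight (V ∪ G) (heights G f g t) S} = B := by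
  have key : ∀ S ∈ B, ∀ᶠ t in Filter.atBot, Tight (V ∪ G) (heights G f g t) S := by
    intro S hS
    obtain ⟨hSV, ℓ, h1, h2⟩ := hf S hS
    have hev : ∀ v ∈ (G : Set E), ∀ᶠ t in Filter.atBot, Real.exp t * ⟪ℓ, v⟫ < g v := fun v hv =>
      (by simpa using Real.tendsto_exp_atBot.mul_const ⟪ℓ, v⟫ :
        Filter.Tendsto (fun t => Real.exp t * ⟪ℓ, v⟫) Filter.atBot (nhds 0)).eventually_lt_const
        (hg v hv)
    filter_upwards [(Filter.eventually_all_finite G.finite_toSet).2 hev] with t ht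
    refine ⟨hSV.trans Finset.subset_union_left, Real.exp t • ℓ, fun v hv => ?_,
      fun v hv hvS => ?_⟩
    · rw [heights, if_neg (Finset.disjoint_left.1 hVG (hSV hv)), real_inner_smul_left, h1 v hv]
    · rw [heights, real_inner_smul_left]
      split_ifs with hvG
      · exact ht v hvG
      · exact mul_lt_mul_of_pos_left
          (h2 v ((Finset.mem_union.1 hv).resolve_right hvG) hvS) (Real.exp_pos t)
  filter_upwards [(Filter.eventually_all_finite hB.finite).2 key] with t ht
  ext S
  exact tight_iff_mem hB hc ht

lemma heights_eventually_atTop {V G : Finset E} (hVG : Disjoint V G) {f g : E → ℝ}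
    (hf : ∀ v ∈ V, 0 < f v) (hG : ∀ x, InCone G x) :
    ∀ᶠ t in Filter.atTop, {S | Tight (V ∪ G) (heights G f g t) S} = {S | Tight G g S} := by
  obtain ⟨M, hM⟩ := exists_norm_bound (V := G) (ω := fun _ => g) (fun v => continuous_const) hG 0
  replace hM := hM.self_of_nhds
  have hev : ∀ v ∈ (V : Set E), ∀ᶠ t in Filter.atTop, M * ‖v‖ < Real.exp t * f v := fun v hv =>
    (Real.tendsto_exp_atTop.atTop_mul_const (hf v hv)).eventually_gt_atTop _
  filter_upwards [(Filter.eventually_all_finite V.finite_toSet).2 hev] with t ht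
  have hbd : ∀ ℓ : E, (∀ v ∈ G, ⟪ℓ, v⟫ ≤ g v) → ∀ v ∈ V, ⟪ℓ, v⟫ < heights G f g t v := by
    intro ℓ hℓ v hv
    rw [heights, if_neg (Finset.disjoint_left.1 hVG hv)]
    exact ((real_inner_le_norm _ _).trans
      (mul_le_mul_of_nonneg_right (hM ℓ hℓ) (norm_nonneg v))).trans_lt (ht v hv)
  have hgv : ∀ v ∈ G, heights G f g t v = g v := fun v hv => if_pos hv
  ext S
  constructor
  · intro hS
    have hS' : Tight (V ∪ G) (heights G f g t) S := hS
    obtain ⟨ℓ, h1, h2, h3⟩ := hS'.le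
    have hℓ := hbd ℓ fun v hv => hgv v hv ▸ h3 v (Finset.mem_union_right _ hv)
    have hSG : S ⊆ G := fun v hv => (Finset.mem_union.1 (hS'.1 hv)).resolve_left
      fun h => (hℓ v h).ne (h1 v hv)
    exact ⟨hSG, ℓ, fun v hv => hgv v (hSG hv) ▸ h1 v hv, fun v hv hvS =>
      hgv v hv ▸ h2 v (Finset.mem_union_right _ hv) hvS⟩
  · intro hS
    have hS' : Tight G g S := hS
    obtain ⟨ℓ, h1, h2, h3⟩ := hS'.le
    refine ⟨hS'.1.trans Finset.subset_union_right, ℓ, fun v hv => (hgv v (hS'.1 hv)).symm ▸ h1 v hv,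
      fun v hv hvS => ?_⟩
    rcases Finset.mem_union.1 hv with h | h
    · exact hbd ℓ h3 v h
    · exact (hgv v h).symm ▸ h2 v h hvS

lemma sum_heights {V G Z : Finset E} (hVG : Disjoint V G) (hZ : Z ⊆ V ∪ G) {α : E → ℝ}
    (hα : ∀ v, v ∉ Z → α v = 0) (f g : E → ℝ) (t : ℝ) :
    ∑ v ∈ Z, α v * heights G f g t v =
      Real.exp t * ∑ v ∈ V, α v * f v + ∑ v ∈ G, α v * g v := by
  rw [Finset.sum_subset hZ fun v _ hv => by rw [hα v hv, zero_mul], Finset.sum_union hVG,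
    Finset.mul_sum]
  congr 1
  · refine Finset.sum_congr rfl fun v hv => ?_
    rw [heights, if_neg (Finset.disjoint_left.1 hVG hv)]; ring
  · exact Finset.sum_congr rfl fun v hv => by rw [heights, if_pos hv]

/-- A set which is tight for the interpolating heights meets the old vertices in a face. -/
lemma inter_mem_of_tight_heights {B : Set (Finset E)} (hB : IsFan B) (hc : Complete B)
    {V G : Finset E} (hVG : Disjoint V G) {f g : E → ℝ} (hf : ∀ S ∈ B, Tight V f S) {t : ℝ}
    {S : Finset E} (hS : Tight (V ∪ G) (heights G f g t) S) : S ∩ V ∈ B := by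
  obtain ⟨-, ℓ, h1, h2⟩ := hS
  have hval : ∀ v ∈ V, heights G f g t v = Real.exp t * f v := fun v hv =>
    if_neg (Finset.disjoint_left.1 hVG hv)
  have he := Real.exp_pos t
  refine (tight_iff_mem hB hc hf).1 ⟨Finset.inter_subset_right, (Real.exp t)⁻¹ • ℓ,
    fun v hv => ?_, fun v hv hvS => ?_⟩
  · rw [Finset.mem_inter] at hv
    rw [real_inner_smul_left, h1 v hv.1, hval v hv.2, inv_mul_cancel_left₀ he.ne']
  · have := h2 v (Finset.mem_union_left _ hv) fun h => hvS (Finset.mem_inter.2 ⟨h, hv⟩)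
    rw [hval v hv] at this
    rwa [real_inner_smul_left, inv_mul_lt_iff₀ he]

/-- If no two circuits become tight simultaneously, the interpolating heights are generic. -/
lemma heights_isSwitch {B : Set (Finset E)} (hB : IsFan B) (hc : Complete B)
    {V G : Finset E} (hVG : Disjoint V G) (hG : GenericTo B G) {f g : E → ℝ}
    (hf : ∀ S ∈ B, Tight V f S) (α : Finset E → E → ℝ)
    (hα : ∀ Z ∈ potentials B G, IsCircuit Z (α Z) ∧ ∀ v, v ∉ Z → α Z v = 0)
    (h1 : ∀ Z ∈ potentials B G, ∑ v ∈ G, α Z v * g v ≠ 0)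
    (h2 : ∀ Z ∈ potentials B G, ∀ Z' ∈ potentials B G, Z ≠ Z' →
      (∑ v ∈ V, α Z v * f v) * ∑ v ∈ G, α Z' v * g v ≠
        (∑ v ∈ V, α Z' v * f v) * ∑ v ∈ G, α Z v * g v) (t : ℝ) :
    (∀ S, Tight (V ∪ G) (heights G f g t) S → Indep S) ∨ IsSwitch (V ∪ G) (heights G f g) t := by
  by_cases hi : ∀ S, Tight (V ∪ G) (heights G f g t) S → Indep S
  · exact Or.inl hi
  refine Or.inr ?_
  push Not at hi
  obtain ⟨S₀, hS₀, hS₀i⟩ := hi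
  have hdec : ∀ Z ⊆ V ∪ G, Z ∩ V ∪ Z ∩ G = Z := fun Z hZ => by
    rw [← Finset.inter_union_distrib_left, Finset.inter_eq_left.2 hZ]
  have hpot : ∀ S, Tight (V ∪ G) (heights G f g t) S → ∀ Z ⊆ S,
      Z.card = Module.finrank ℝ E + 1 → Z ∈ potentials B G := fun S hS Z hZ hcard =>
    ⟨hcard, Z ∩ V, hB.down _ (inter_mem_of_tight_heights hB hc hVG hf hS) _
      (Finset.inter_subset_inter_right hZ), Z ∩ G, Finset.inter_subset_right,
      (hdec Z (hZ.trans hS.1)).symm⟩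
  have hzero : ∀ S, Tight (V ∪ G) (heights G f g t) S → ∀ Z ⊆ S, Z ∈ potentials B G →
      Real.exp t * ∑ v ∈ V, α Z v * f v + ∑ v ∈ G, α Z v * g v = 0 := by
    intro S hS Z hZ hZp
    obtain ⟨ℓ, h3, -, -⟩ := hS.le
    rw [← sum_heights hVG (hZ.trans hS.1) (hα Z hZp).2, Finset.sum_congr rfl fun v hv => by
      rw [← h3 v (hZ hv)], ← inner_sum_smul, (hα Z hZp).1.sum_eq, inner_zero_right]
  have huniq : ∀ S, Tight (V ∪ G) (heights G f g t) S → ∀ Z ⊆ S,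
      Z.card = Module.finrank ℝ E + 1 → ∀ S', Tight (V ∪ G) (heights G f g t) S' → ∀ Z' ⊆ S',
      Z'.card = Module.finrank ℝ E + 1 → Z = Z' := by
    intro S hS Z hZ hcard S' hS' Z' hZ' hcard'
    by_contra hne
    have e1 := hzero S hS Z hZ (hpot S hS Z hZ hcard)
    have e2 := hzero S' hS' Z' hZ' (hpot S' hS' Z' hZ' hcard')
    refine h2 Z (hpot S hS Z hZ hcard) Z' (hpot S' hS' Z' hZ' hcard') hne ?_
    linear_combination (∑ v ∈ V, α Z v * f v) * e2 - (∑ v ∈ V, α Z' v * f v) * e1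
  have hbig : ∀ S, Tight (V ∪ G) (heights G f g t) S → ¬ Indep S →
      S.card = Module.finrank ℝ E + 1 := by
    intro S hS hSi
    have hlt : Module.finrank ℝ E + 1 ≤ S.card := by
      by_contra hcon
      refine hSi ?_
      rw [← hdec S hS.1]
      refine hG _ (inter_mem_of_tight_heights hB hc hVG hf hS) _ Finset.inter_subset_right ?_
      rw [← Finset.card_union_of_disjoint (Finset.disjoint_of_subset_left Finset.inter_subset_right
        (Finset.disjoint_of_subset_right Finset.inter_subset_right hVG)), hdec S hS.1]
      omega
    obtain ⟨Z, hZ, hcard⟩ := Finset.exists_subset_card_eq hlt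
    by_contra hne
    obtain ⟨y, hy, hyZ⟩ := Finset.exists_of_ssubset
      (hZ.ssubset_of_ne fun h => hne (h ▸ hcard))
    obtain ⟨z, hz⟩ : Z.Nonempty := Finset.card_pos.1 (by omega)
    have := huniq S hS Z hZ hcard S hS (insert y (Z.erase z))
      (Finset.insert_subset hy ((Finset.erase_subset _ _).trans hZ))
      (by rw [Finset.card_insert_of_notMem fun h => hyZ (Finset.mem_of_mem_erase h),
        Finset.card_erase_add_one hz, hcard])
    exact hyZ (this ▸ Finset.mem_insert_self _ _)
  have hcard := hbig S₀ hS₀ hS₀i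
  have hp := hpot S₀ hS₀ S₀ subset_rfl hcard
  have h0 := hzero S₀ hS₀ S₀ subset_rfl hp
  have hsum := fun s => sum_heights hVG hS₀.1 (hα S₀ hp).2 f g s
  have hB0 := h1 S₀ hp
  set a := ∑ v ∈ V, α S₀ v * f v with ha
  set b := ∑ v ∈ G, α S₀ v * g v with hb
  have hsw : ∀ s, ∑ v ∈ S₀, α S₀ v * heights G f g s v = (Real.exp s - Real.exp t) * a :=
    fun s => by rw [hsum s]; linear_combination h0
  have ha0 : a ≠ 0 := fun h => hB0 (by rw [h] at h0; simpa using h0)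
  have hind : ∀ S, Tight (V ∪ G) (heights G f g t) S → S ≠ S₀ → Indep S := fun S hS hne => by
    by_contra hSi
    exact hne (huniq S hS S subset_rfl (hbig S hS hSi) S₀ hS₀ S₀ subset_rfl hcard)
  rcases ha0.lt_or_gt with h | h
  · refine ⟨S₀, -α S₀, hS₀, hcard, (hα S₀ hp).1.neg, hind, fun s hs => ?_, fun s hs => ?_⟩
    all_goals
      simp only [Pi.neg_apply, neg_mul, Finset.sum_neg_distrib, hsw]
      have := Real.exp_lt_exp.2 hs
      nlinarith
  · refine ⟨S₀, α S₀, hS₀, hcard, (hα S₀ hp).1, hind, fun s hs => ?_, fun s hs => ?_⟩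
    all_goals
      rw [hsw]
      have := Real.exp_lt_exp.2 hs
      nlinarith

/-- A complete fan supported by a height function is connected by moves to a generic fan. -/
lemma moves_generic {B : Set (Finset E)} (hB : IsFan B) (hc : Complete B) {f₀ : E → ℝ}
    (hf₀ : Supported B f₀) {V G : Finset E} (hV : ∀ v, v ∈ V ↔ {v} ∈ B)
    (hcard : G.card = Module.finrank ℝ E + 1) (hunit : ∀ v ∈ G, ‖v‖ = 1) (hVG : Disjoint V G)
    (hG : GenericTo B G) (hspan : ∀ x, InCone G x) {g : E → ℝ} (hg : ∀ v ∈ G, 0 < g v)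
    (α : Finset E → E → ℝ)
    (hα : ∀ Z ∈ potentials B G, IsCircuit Z (α Z) ∧ ∀ v, v ∉ Z → α Z v = 0)
    (h1 : ∀ Z ∈ potentials B G, ∑ v ∈ G, α Z v * g v ≠ 0)
    (h2 : ∀ Z ∈ potentials B G, ∀ Z' ∈ potentials B G, ∀ v ∈ V, v ∈ Z → v ∈ Z' →
      Z ∩ G ≠ Z' ∩ G →
        α Z' v * ∑ w ∈ G, α Z w * g w ≠ α Z v * ∑ w ∈ G, α Z' w * g w) :
    Moves B {S | Tight G g S} ∧ Moves {S | Tight G g S} B := by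
  let I : Set (Finset E × Finset E) := {p | p.1 ≠ p.2} ∩ potentials B G ×ˢ potentials B G
  let c : Finset E × Finset E → E → ℝ := fun p v =>
    α p.1 v * ∑ w ∈ G, α p.2 w * g w - α p.2 v * ∑ w ∈ G, α p.1 w * g w
  have hI : I.Finite := ((finite_potentials hB.finite G).prod
    (finite_potentials hB.finite G)).inter_of_right _
  have hsub : ∀ Z ∈ potentials B G, Z ⊆ V ∪ G := by
    rintro Z ⟨-, W₁, k1, W₂, k2, rfl⟩
    exact Finset.union_subset_union (fun v hv => (hV v).2 (hB.singleton_mem k1 hv)) k2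
  have hC : ∀ d ∈ c '' I, ∃ v ∈ V, d v ≠ 0 := by
    rintro d ⟨⟨Z, Z'⟩, ⟨hne, hZ, hZ'⟩, rfl⟩
    dsimp only [Set.mem_ofPred_eq] at hne hZ hZ'
    have hnz := (hα Z hZ).1.ne_zero
    have hnz' := (hα Z' hZ').1.ne_zero
    change ∃ v ∈ V, α Z v * ∑ w ∈ G, α Z' w * g w - α Z' v * ∑ w ∈ G, α Z w * g w ≠ 0
    by_cases hex : ∃ v ∈ V, ¬ (v ∈ Z ↔ v ∈ Z')
    · obtain ⟨v, hv, hvZ⟩ := hex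
      refine ⟨v, hv, ?_⟩
      by_cases h : v ∈ Z
      · have h' : v ∉ Z' := fun h' => hvZ ⟨fun _ => h', fun _ => h⟩
        rw [(hα Z' hZ').2 v h', zero_mul, sub_zero]
        exact mul_ne_zero (hnz v h) (h1 Z' hZ')
      · have h' : v ∈ Z' := by
          by_contra h'
          exact hvZ ⟨fun k => absurd k h, fun k => absurd k h'⟩
        rw [(hα Z hZ).2 v h, zero_mul, zero_sub, neg_ne_zero]
        exact mul_ne_zero (hnz' v h') (h1 Z hZ)
    · push Not at hex
      have hGne : Z ∩ G ≠ Z' ∩ G := fun heq => hne <| Finset.ext fun v => by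
        by_cases hv : v ∈ V
        · exact hex v hv
        · have e := Finset.ext_iff.1 heq v
          simp only [Finset.mem_inter] at e
          exact ⟨fun h => (e.1 ⟨h, (Finset.mem_union.1 (hsub Z hZ h)).resolve_left hv⟩).1,
            fun h => (e.2 ⟨h, (Finset.mem_union.1 (hsub Z' hZ' h)).resolve_left hv⟩).1⟩
      obtain ⟨v, hv, hvZ⟩ : ∃ v ∈ V, v ∈ Z := by
        by_contra hcon
        push Not at hcon
        have hZG : ∀ Y ∈ potentials B G, (∀ v ∈ V, v ∉ Y) → Y = G := fun Y hY h =>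
          Finset.eq_of_subset_of_card_le (fun v hv =>
            (Finset.mem_union.1 (hsub Y hY hv)).resolve_left fun hvV => h v hvV hv)
            (by rw [hcard, hY.1])
        exact hne ((hZG Z hZ hcon).trans
          (hZG Z' hZ' fun v hv h => hcon v hv ((hex v hv).2 h)).symm)
      exact ⟨v, hv, sub_ne_zero.2 fun h =>
        h2 Z hZ Z' hZ' v hv hvZ ((hex v hv).1 hvZ) hGne h.symm⟩
  obtain ⟨U, hU, hUo, hfU⟩ := eventually_nhds_iff.1 (hf₀.eventually hB hc hV)
  obtain ⟨f, hf, hfc⟩ := exists_mem_forall_sum_ne V (hI.image c) hC hUo ⟨f₀, hfU⟩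
  obtain ⟨hfpos, hft⟩ := hU f hf
  refine moves_of_family_symm (V := V ∪ G) (ω := heights G f g) (fun v => ?_)
    (fun x => (hspan x).mono Finset.subset_union_right) (fun v hv => ?_) (fun t v hv => ?_)
    (heights_isSwitch hB hc hVG hG hft α hα h1 fun Z hZ Z' hZ' hne => ?_)
    (heights_eventually_atBot hB hc hVG hg hft) (heights_eventually_atTop hVG hfpos hspan)
  · unfold heights
    split_ifs <;> fun_prop
  · rcases Finset.mem_union.1 hv with h | h
    · exact hB.unit _ ((hV v).1 h) v (Finset.mem_singleton_self v)
    · exact hunit v h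
  · unfold heights
    split_ifs with h
    · exact hg v h
    · exact mul_pos (Real.exp_pos t) (hfpos v ((Finset.mem_union.1 hv).resolve_right h))
  · have := hfc _ ⟨(Z, Z'), ⟨hne, hZ, hZ'⟩, rfl⟩
    rw [← sub_ne_zero, Finset.sum_mul, Finset.sum_mul, ← Finset.sum_sub_distrib]
    convert this using 2
    ring_nf
    simp only [c]
    ring

lemma moves_of_supported (hd : 2 ≤ Module.finrank ℝ E) {B₁ B₂ : Set (Finset E)} (hB₁ : IsFan B₁)
    (hc₁ : Complete B₁) (hB₂ : IsFan B₂) (hc₂ : Complete B₂) {f₁ f₂ : E → ℝ}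
    (hf₁ : Supported B₁ f₁) (hf₂ : Supported B₂ f₂) : Moves B₁ B₂ := by
  set V₁ := hB₁.finite_verts.toFinset with hV₁
  set V₂ := hB₂.finite_verts.toFinset with hV₂
  have m₁ : ∀ v, v ∈ V₁ ↔ {v} ∈ B₁ := fun v => by simp [hV₁]
  have m₂ : ∀ v, v ∈ V₂ ↔ {v} ∈ B₂ := fun v => by simp [hV₂]
  obtain ⟨G, hcard, hunit, hdisj, hgen, hspan⟩ := exists_generic (P := B₁ ∪ B₂)
    (hB₁.finite.union hB₂.finite) (Or.inl hB₁.empty_mem)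
    (fun s hs => hs.elim hB₁.indep hB₂.indep) hd (V₁ ∪ V₂)
  rw [Finset.disjoint_union_left] at hdisj
  have g₁ : GenericTo B₁ G := fun W hW => hgen W (Or.inl hW)
  have g₂ : GenericTo B₂ G := fun W hW => hgen W (Or.inr hW)
  have d₁ : ∀ s ∈ B₁, Disjoint s G := fun s hs => Finset.disjoint_of_subset_left
    (fun v hv => (m₁ v).2 (hB₁.singleton_mem hs hv)) hdisj.1
  have d₂ : ∀ s ∈ B₂, Disjoint s G := fun s hs => Finset.disjoint_of_subset_left
    (fun v hv => (m₂ v).2 (hB₂.singleton_mem hs hv)) hdisj.2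
  have hex : ∀ Z ∈ potentials B₁ G ∪ potentials B₂ G,
      ∃ α, IsCircuit Z α ∧ ∀ v, v ∉ Z → α v = 0 := fun Z hZ =>
    hZ.elim (exists_isCircuit_of_potentials hB₁ g₁ d₁) (exists_isCircuit_of_potentials hB₂ g₂ d₂)
  choose! α hα using hex
  obtain ⟨g, hg, h1, h2⟩ := exists_generic_height (G := G)
    ((finite_potentials hB₁.finite G).union (finite_potentials hB₂.finite G)) α
    (fun Z hZ v => ⟨fun h => by by_contra hv; exact h ((hα Z hZ).2 v hv),
      (hα Z hZ).1.ne_zero v⟩)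
    (fun Z hZ => hZ.elim (inter_nonempty_of_potentials hB₁) (inter_nonempty_of_potentials hB₂))
    (V₁ ∪ V₂)
  have r₁ := moves_generic hB₁ hc₁ hf₁ m₁ hcard hunit hdisj.1 g₁ hspan hg α
    (fun Z hZ => hα Z (Or.inl hZ)) (fun Z hZ => h1 Z (Or.inl hZ))
    fun Z hZ Z' hZ' v hv => h2 Z (Or.inl hZ) Z' (Or.inl hZ') v (Finset.mem_union_left _ hv)
  have r₂ := moves_generic hB₂ hc₂ hf₂ m₂ hcard hunit hdisj.2 g₂ hspan hg α
    (fun Z hZ => hα Z (Or.inr hZ)) (fun Z hZ => h1 Z (Or.inr hZ))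
    fun Z hZ Z' hZ' v hv => h2 Z (Or.inr hZ) Z' (Or.inr hZ') v (Finset.mem_union_right _ hv)
  exact r₁.1.trans r₂.2

lemma IsFan.eq_of_finrank_le_one (hd : Module.finrank ℝ E ≤ 1) {F F' : Set (Finset E)}
    (hF : IsFan F) (hc : Complete F) (hF' : IsFan F') (hc' : Complete F') : F = F' := by
  suffices h : ∀ {F F' : Set (Finset E)}, IsFan F → IsFan F' → Complete F' → F ⊆ F' from
    subset_antisymm (h hF hF' hc') (h hF' hF hc)
  intro F F' hF hF' hc' S hS
  rcases Finset.eq_empty_or_nonempty S with rfl | ⟨v, hv⟩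
  · exact hF'.empty_mem
  · have hSv : S = {v} := Finset.eq_singleton_iff_unique_mem.2 ⟨hv, fun w hw =>
      Finset.card_le_one.1 ((hF.indep hS).card_le.trans hd) w hw v hv⟩
    obtain ⟨s, hs, a, ha, hsum⟩ := hc' v
    rcases Finset.eq_empty_or_nonempty s with rfl | ⟨w, hw⟩
    · exact absurd hsum.symm (hF.ne_zero hS hv)
    · have hsw : s = {w} := Finset.eq_singleton_iff_unique_mem.2 ⟨hw, fun x hx =>
        Finset.card_le_one.1 ((hF'.indep hs).card_le.trans hd) x hx w hw⟩
      subst hsw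
      have h1 := hF.unit S hS v hv
      rw [Finset.sum_singleton] at hsum
      rw [← hsum, norm_smul, hF'.unit _ hs w hw, mul_one, Real.norm_eq_abs,
        abs_of_pos (ha w hw)] at h1
      rw [h1, one_smul] at hsum
      rw [hSv, ← hsum]
      exact hs

end Connect

/-! ### Spherical complexes and fans -/

section Bridge

lemma mem_sphSimplex {m : ℕ} {s : Finset (EuclideanSpace ℝ (Fin m))}
    {x : EuclideanSpace ℝ (Fin m)} : x ∈ sphSimplex s ↔ ‖x‖ = 1 ∧ InCone s x := by
  constructor
  · rintro ⟨y, ⟨hy, hy0⟩, rfl⟩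
    have hy0 : y ≠ 0 := hy0
    obtain ⟨a, ha, -, hay⟩ := Finset.mem_convexHull'.1 hy
    refine ⟨?_, InCone.smul ⟨a, ha, hay⟩ (by positivity)⟩
    rw [norm_smul, norm_inv, norm_norm, inv_mul_cancel₀ (norm_ne_zero_iff.2 hy0)]
  · rintro ⟨hx, a, ha, hax⟩
    have hx0 : x ≠ 0 := fun h => by simp [h] at hx
    have hA : 0 < ∑ v ∈ s, a v := by
      refine lt_of_le_of_ne (Finset.sum_nonneg ha) fun h => hx0 ?_
      rw [← hax]
      exact Finset.sum_eq_zero fun v hv => by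
        rw [(Finset.sum_eq_zero_iff_of_nonneg ha).1 h.symm v hv, zero_smul]
    set A := ∑ v ∈ s, a v with hAd
    refine ⟨A⁻¹ • x, ⟨?_, smul_ne_zero (inv_ne_zero hA.ne') hx0⟩, ?_⟩
    · refine Finset.mem_convexHull'.2 ⟨fun v => A⁻¹ * a v,
        fun v hv => mul_nonneg (inv_nonneg.2 hA.le) (ha v hv), ?_, ?_⟩
      · rw [← Finset.mul_sum, ← hAd, inv_mul_cancel₀ hA.ne']
      · simp only [mul_smul]
        rw [← Finset.smul_sum, hax]
    · beta_reduce
      rw [norm_smul, hx, norm_inv, Real.norm_eq_abs, abs_of_pos hA, mul_one, inv_inv, smul_smul,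
        mul_inv_cancel₀ hA.ne', one_smul]

variable {E : Type*} [NormedAddCommGroup E] [InnerProductSpace ℝ E]

lemma Indep.subset_of_inCone {s t : Finset E} (hs : Indep s) {x : E} (hx : PosComb s x)
    (hts : t ⊆ s) (hxt : InCone t x) : s ⊆ t := by
  obtain ⟨a, ha, hax⟩ := hx
  obtain ⟨c, -, hcx⟩ := hxt
  rw [← sum_smul_subset hts, ← hax] at hcx
  intro v hv
  by_contra hvt
  have := hs.coeff_eq hcx v hv
  rw [if_neg hvt] at this
  exact (ha v hv).ne this

lemma Indep.eq_empty {s : Finset E} (hs : Indep s) (hx : PosComb s (0 : E)) : s = ∅ := by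
  obtain ⟨a, ha, hax⟩ := hx
  exact Finset.eq_empty_of_forall_notMem fun v hv => (ha v hv).ne' (hs a hax v hv)

variable {n : ℕ}

lemma isFan_of_complex (K : SphericalComplex n) : IsFan (insert ∅ K.faces) := by
  have hi : ∀ s ∈ insert ∅ K.faces, Indep s := by
    rintro s (rfl | hs)
    · intro a _ v hv
      exact absurd hv (Finset.notMem_empty v)
    · exact indep_iff.2 (K.indep s hs)
  refine ⟨K.finite'.insert _, mem_insert _ _, ?_, ?_, ?_⟩
  · rintro s (rfl | hs) v hv
    · exact absurd hv (Finset.notMem_empty v)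
    · exact K.unit s hs v hv
  · rintro s hs t hts
    rcases t.eq_empty_or_nonempty with rfl | ht
    · exact mem_insert _ _
    · rcases hs with rfl | hs
      · rw [Finset.subset_empty.1 hts]; exact mem_insert _ _
      · exact mem_insert_of_mem _ (K.down_closed s hs t hts ht)
  · intro s hs t ht x hxs hxt
    by_cases hx : x = 0
    · subst hx
      rw [(hi s hs).eq_empty hxs, (hi t ht).eq_empty hxt]
    · have hs' : s ∈ K.faces := hs.resolve_left fun h => hx (posComb_empty.1 (h ▸ hxs))
      have ht' : t ∈ K.faces := ht.resolve_left fun h => hx (posComb_empty.1 (h ▸ hxt))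
      have hc : 0 < ‖x‖⁻¹ := inv_pos.2 (norm_pos_iff.2 hx)
      have hn : ‖‖x‖⁻¹ • x‖ = 1 := by
        rw [norm_smul, norm_inv, norm_norm, inv_mul_cancel₀ (norm_ne_zero_iff.2 hx)]
      have hmem : ‖x‖⁻¹ • x ∈ sphSimplex s ∩ sphSimplex t :=
        ⟨mem_sphSimplex.2 ⟨hn, (hxs.smul hc).inCone⟩, mem_sphSimplex.2 ⟨hn, (hxt.smul hc).inCone⟩⟩
      rw [K.inter s hs' t ht'] at hmem
      have h := (mem_sphSimplex.1 hmem).2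
      have h1 := (hi s hs).subset_of_inCone (hxs.smul hc) Finset.inter_subset_left h
      have h2 := (hi t ht).subset_of_inCone (hxt.smul hc) Finset.inter_subset_right h
      exact subset_antisymm (h1.trans Finset.inter_subset_right)
        (h2.trans Finset.inter_subset_left)

lemma complete_of_complex (K : SphericalComplex n)
    (hK : K.space = {x : EuclideanSpace ℝ (Fin (n + 1)) | ‖x‖ = 1}) :
    Complete (insert ∅ K.faces) := by
  intro x
  by_cases hx : x = 0
  · exact ⟨∅, mem_insert _ _, posComb_empty.2 hx⟩
  · have hn : ‖x‖⁻¹ • x ∈ K.space := by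
      rw [hK, Set.mem_ofPred_eq, norm_smul, norm_inv, norm_norm,
        inv_mul_cancel₀ (norm_ne_zero_iff.2 hx)]
    simp only [SphericalComplex.space, Set.mem_iUnion] at hn
    obtain ⟨s, hs, hxs⟩ := hn
    obtain ⟨s', hs', h⟩ := (mem_sphSimplex.1 hxs).2.exists_posComb
    refine ⟨s', (isFan_of_complex K).down s (mem_insert_of_mem _ hs) s' hs', ?_⟩
    have := h.smul (norm_pos_iff.2 hx)
    rwa [smul_smul, mul_inv_cancel₀ (norm_ne_zero_iff.2 hx), one_smul] at this

/-- The spherical complex cut out by a fan on the unit sphere. -/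
def IsFan.toComplex {F : Set (Finset (EuclideanSpace ℝ (Fin (n + 1))))} (hF : IsFan F) :
    SphericalComplex n where
  faces := {S | S ∈ F ∧ S.Nonempty}
  finite' := hF.finite.subset fun _ h => h.1
  nonempty_mem _ h := h.2
  unit s h := hF.unit s h.1
  indep s h := indep_iff.1 (hF.indep h.1)
  down_closed s h t hts ht := ⟨hF.down s h.1 t hts, ht⟩
  inter s hs t ht := by
    ext x
    simp only [Set.mem_inter_iff, mem_sphSimplex]
    constructor
    · rintro ⟨⟨hx, h1⟩, -, h2⟩
      obtain ⟨s', hs', h1⟩ := h1.exists_posComb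
      obtain ⟨t', ht', h2⟩ := h2.exists_posComb
      have := hF.uniq s' (hF.down s hs.1 s' hs') t' (hF.down t ht.1 t' ht') x h1 h2
      exact ⟨hx, h1.inCone.mono (Finset.subset_inter hs' (this ▸ ht'))⟩
    · rintro ⟨hx, h⟩
      exact ⟨⟨hx, h.mono Finset.inter_subset_left⟩, hx, h.mono Finset.inter_subset_right⟩

lemma complex_ext {K L : SphericalComplex n} (h : K.faces = L.faces) : K = L := by
  cases K; cases L; cases h; rfl

variable {F F' : Set (Finset (EuclideanSpace ℝ (Fin (n + 1))))}

lemma IsFan.mem_sphInterior (hF : IsFan F) {s : Finset (EuclideanSpace ℝ (Fin (n + 1)))}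
    (hs : s ∈ F) {x : EuclideanSpace ℝ (Fin (n + 1))} (hx : PosComb s x) (hn : ‖x‖ = 1) :
    x ∈ sphInterior s := by
  refine ⟨mem_sphSimplex.2 ⟨hn, hx.inCone⟩, fun h => ?_⟩
  simp only [Set.mem_iUnion] at h
  obtain ⟨t, ht, hxt⟩ := h
  have ht : t ⊂ s := ht
  exact ht.not_subset ((hF.indep hs).subset_of_inCone hx ht.subset (mem_sphSimplex.1 hxt).2)

lemma IsFan.sphIsDerived (hF : IsFan F) {b : Finset (EuclideanSpace ℝ (Fin (n + 1))) →
    EuclideanSpace ℝ (Fin (n + 1))} (hb : IsCenter F b) (hF' : IsFan F') (h : F' = derived F b) :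
    SphIsDerived hF'.toComplex hF.toComplex := by
  subst h
  refine ⟨b, fun s hs => hF.mem_sphInterior hs.1 (hb s hs.1 hs.2).1 (hb s hs.1 hs.2).2, ?_⟩
  ext S
  constructor
  · rintro ⟨⟨T, hT, rfl⟩, hne⟩
    exact ⟨T, fun A hA => hT.1 A hA, Finset.image_nonempty.1 hne, hT.2, rfl⟩
  · rintro ⟨T, hT, hne, hch, rfl⟩
    exact ⟨⟨T, ⟨fun A hA => hT hA, hch⟩, rfl⟩, hne.image b⟩

lemma sphIterDerived_of_iterDerived (K : SphericalComplex n) :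
    ∀ (s : ℕ) {B : Set (Finset (EuclideanSpace ℝ (Fin (n + 1))))} (hB : IsFan B),
      IterDerived s B (insert ∅ K.faces) → SphIterDerived s hB.toComplex K := by
  intro s
  induction s with
  | zero =>
    rintro B hB rfl
    refine complex_ext (Set.ext fun S => ⟨fun h => h.1.resolve_left h.2.ne_empty, fun h =>
      ⟨mem_insert_of_mem _ h, K.nonempty_mem S h⟩⟩)
  | succ s ih =>
    rintro B hB ⟨F, b, h, hF, hb, hBd⟩
    exact ⟨hF.toComplex, ih hF h, hF.sphIsDerived hb hB hBd⟩

lemma FanMove.sphBistellarMove (h : FanMove F F') (hF : IsFan F) (hF' : IsFan F') :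
    SphBistellarMove hF.toComplex hF'.toComplex := by
  obtain ⟨-, -, A, B, hA, hAF, hBF, hB, hcard, hlk, rfl⟩ := h
  refine ⟨A, B, ⟨hAF, hA⟩, fun h => hBF h.1, hB, ?_, ?_, ?_⟩
  · simpa using hcard
  · rw [← hlk]
    ext C
    exact ⟨fun h => ⟨h.1, h.2.1, h.2.2.1⟩,
      fun h => ⟨h.1, h.2.1, h.2.2, hA.mono Finset.subset_union_left⟩⟩
  · ext S
    constructor
    · rintro ⟨h | h, hne⟩
      · exact Or.inl ⟨⟨h.1, hne⟩, h.2⟩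
      · exact Or.inr h
    · rintro (h | ⟨A', hA', rfl⟩)
      · exact ⟨Or.inl ⟨h.1.1, h.2⟩, h.1.2⟩
      · exact ⟨Or.inr ⟨A', hA', rfl⟩, hB.mono Finset.subset_union_right⟩

lemma Moves.sphBistellarMoves (h : Moves F F') (hF : IsFan F) :
    ∀ hF' : IsFan F', Relation.ReflTransGen SphBistellarMove hF.toComplex hF'.toComplex := by
  induction h with
  | refl => exact fun _ => Relation.ReflTransGen.refl
  | tail _ hm ih => exact fun hF' => (ih hm.1).tail (hm.sphBistellarMove hm.1 hF')

end Bridge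

end SphFan

/-- Let `K₁`, `K₂` be geometric simplicial triangulations of the round sphere
`Sⁿ` (by spherical geodesic simplices) in which the star of every simplex has diameter less
than `π` in the intrinsic (angular) metric of `Sⁿ`. Then there are `s ∈ ℕ` and `s`-fold derived
subdivisions `βˢK₁`, `βˢK₂` related by a finite sequence of geometric bistellar moves. -/
theorem statement14 {n : ℕ} (K₁ K₂ : SphericalComplex n)
    (hK₁ : K₁.space = {x : EuclideanSpace ℝ (Fin (n + 1)) | ‖x‖ = 1})
    (hK₂ : K₂.space = {x : EuclideanSpace ℝ (Fin (n + 1)) | ‖x‖ = 1})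
    (hstar₁ : ∀ A ∈ K₁.faces, ∀ x ∈ sphStar K₁ A, ∀ y ∈ sphStar K₁ A,
      Real.arccos ⟪x, y⟫ < Real.pi)
    (hstar₂ : ∀ A ∈ K₂.faces, ∀ x ∈ sphStar K₂ A, ∀ y ∈ sphStar K₂ A,
      Real.arccos ⟪x, y⟫ < Real.pi) :
    ∃ (s : ℕ) (B₁ B₂ : SphericalComplex n),
      SphIterDerived s B₁ K₁ ∧ SphIterDerived s B₂ K₂ ∧
      Relation.ReflTransGen SphBistellarMove B₁ B₂ := by
  obtain ⟨s, B₁, B₂, h₁, h₂, ⟨hB₁, hc₁, f₁, hf₁⟩, hB₂, hc₂, f₂, hf₂⟩ :=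
    SphFan.exists_common_supported (SphFan.isFan_of_complex K₁) (SphFan.complete_of_complex K₁ hK₁)
      (SphFan.isFan_of_complex K₂) (SphFan.complete_of_complex K₂ hK₂)
  have hm : SphFan.Moves B₁ B₂ := by
    by_cases hd : 2 ≤ Module.finrank ℝ (EuclideanSpace ℝ (Fin (n + 1)))
    · exact SphFan.moves_of_supported hd hB₁ hc₁ hB₂ hc₂ hf₁ hf₂
    · rw [hB₁.eq_of_finrank_le_one (by omega) hc₁ hB₂ hc₂]
      exact Relation.ReflTransGen.refl
  exact ⟨s, hB₁.toComplex, hB₂.toComplex, SphFan.sphIterDerived_of_iterDerived K₁ s hB₁ h₁,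
    SphFan.sphIterDerived_of_iterDerived K₂ s hB₂ h₂, hm.sphBistellarMoves hB₁ hB₂⟩
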